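/- Let {A(t) : t ≥ 0} belong to the Kato class with common domain D, and let Q : [0,∞) → L(X) be a family of isomorphisms such that Q is strongly C²-continuous and Q⁻¹ is strongly continuous. Then {Q(t)⁻¹A(t)Q(t) : t ≥ 0} generates a unique evolution family W with regularity spaces Y_t = Q(t)⁻¹D, t ≥ 0. Moreover, for each F ∈ C¹([0,∞); X), s > 0 and x_s ∈ Q(s)⁻¹D, the inhomogeneous non-autonomous Cauchy problem ẋ(t) = Q(t)⁻¹A(t)Q(t)x(t) + F(t) on [s,∞), x(s) = x_s, has a unique classical solution, given by x(t) = W(t,s)x_s + ∫_s^t W(t,r)F(r) dr for t ≥ s. -/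

import Mathlib

open Set Filter MeasureTheory
open scoped ComplexInnerProductSpace

noncomputable section

namespace NBCS

/-! ### Evolution families and non-autonomous Cauchy problems -/

section NormedDefs

variable {X U Y : Type*}
variable [NormedAddCommGroup X] [NormedSpace ℂ X]
variable [NormedAddCommGroup U] [NormedSpace ℂ U]
variable [NormedAddCommGroup Y] [NormedSpace ℂ Y]

/-- An evolution family on `X`, indexed by `Δ = {(t,s) : 0 ≤ s ≤ t}`. -/
def IsEvolutionFamily (W : ℝ → ℝ → X →L[ℂ] X) : Prop :=
  (∀ t, 0 ≤ t → W t t = 1) ∧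
  (∀ s r t : ℝ, 0 ≤ s → s ≤ r → r ≤ t → W t s = (W t r).comp (W r s)) ∧
  (∀ x : X, ContinuousOn (fun p : ℝ × ℝ => W p.1 p.2 x) {p : ℝ × ℝ | 0 ≤ p.2 ∧ p.2 ≤ p.1})

/-- A backward evolution family on `X`. -/
def IsBackwardEvolutionFamily (V : ℝ → ℝ → X →L[ℂ] X) : Prop :=
  (∀ t, 0 ≤ t → V t t = 1) ∧
  (∀ s r t : ℝ, 0 ≤ s → s ≤ r → r ≤ t → V t s = (V r s).comp (V t r)) ∧
  (∀ x : X, ContinuousOn (fun p : ℝ × ℝ => V p.1 p.2 x) {p : ℝ × ℝ | 0 ≤ p.2 ∧ p.2 ≤ p.1})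

/-- A classical solution (continuous on `[s,∞)`, `C¹` on `(s,∞)`) of the inhomogeneous
non-autonomous Cauchy problem `ẋ(t) = A(t)x(t) + F(t)` on `[s,∞)`, `x(s) = xs`, where the
(in general unbounded) operator `A(t)` is encoded by a globally defined linear map together
with its domain `domA t`. -/
def IsClassicalSolution (A : ℝ → X →ₗ[ℂ] X) (domA : ℝ → Submodule ℂ X)
    (F : ℝ → X) (s : ℝ) (xs : X) (x : ℝ → X) : Prop :=
  ContinuousOn x (Ici s) ∧ x s = xs ∧ (∀ t, s ≤ t → x t ∈ domA t) ∧
  (∀ t, s < t → HasDerivAt x (A t (x t) + F t) t) ∧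
  ContinuousOn (fun t => A t (x t) + F t) (Ioi s)

/-- A classical solution which is `C¹` up to the initial time `s`. -/
def IsClassicalSolutionC1 (A : ℝ → X →ₗ[ℂ] X) (domA : ℝ → Submodule ℂ X)
    (F : ℝ → X) (s : ℝ) (xs : X) (x : ℝ → X) : Prop :=
  x s = xs ∧ (∀ t, s ≤ t → x t ∈ domA t) ∧
  (∀ t, s ≤ t → HasDerivWithinAt x (A t (x t) + F t) (Ici s) t) ∧
  ContinuousOn (fun t => A t (x t) + F t) (Ici s)

/-- The family `{A(t)}` generates the evolution family `W` with regularity spaces `Yreg`. -/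
def Generates (A : ℝ → X →ₗ[ℂ] X) (domA : ℝ → Submodule ℂ X)
    (W : ℝ → ℝ → X →L[ℂ] X) (Yreg : ℝ → Submodule ℂ X) : Prop :=
  IsEvolutionFamily W ∧
  (∀ t, 0 ≤ t → Dense (Yreg t : Set X)) ∧
  (∀ t, 0 ≤ t → Yreg t ≤ domA t) ∧
  (∀ s t : ℝ, 0 ≤ s → s ≤ t → ∀ x ∈ Yreg s, W t s x ∈ Yreg t) ∧
  (∀ s, 0 ≤ s → ∀ xs ∈ Yreg s,
    IsClassicalSolution A domA (fun _ => 0) s xs (fun t => W t s xs)) ∧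
  (∀ s, 0 ≤ s → ∀ xs ∈ Yreg s, ∀ x, IsClassicalSolution A domA (fun _ => 0) s xs x →
    ∀ t, s ≤ t → x t = W t s xs)

/-- A classical solution of the backward problem `u'(s) = -A(s)u(s)` on `[0,t]`, `u(t) = xt`. -/
def IsBackwardSolution (A : ℝ → X →ₗ[ℂ] X) (domA : ℝ → Submodule ℂ X)
    (t : ℝ) (xt : X) (u : ℝ → X) : Prop :=
  u t = xt ∧ (∀ s ∈ Icc (0:ℝ) t, u s ∈ domA s) ∧
  (∀ s ∈ Icc (0:ℝ) t, HasDerivWithinAt u (-(A s (u s))) (Icc (0:ℝ) t) s) ∧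
  ContinuousOn (fun s => A s (u s)) (Icc (0:ℝ) t)

/-- The family `{A(t)}` generates the backward evolution family `V` with
regularity spaces `Yreg`. -/
def GeneratesBackward (A : ℝ → X →ₗ[ℂ] X) (domA : ℝ → Submodule ℂ X)
    (V : ℝ → ℝ → X →L[ℂ] X) (Yreg : ℝ → Submodule ℂ X) : Prop :=
  IsBackwardEvolutionFamily V ∧
  (∀ t, 0 ≤ t → Dense (Yreg t : Set X)) ∧
  (∀ t, 0 ≤ t → Yreg t ≤ domA t) ∧
  (∀ s t : ℝ, 0 ≤ s → s ≤ t → ∀ x ∈ Yreg t, V t s x ∈ Yreg s) ∧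
  (∀ t, 0 ≤ t → ∀ xt ∈ Yreg t, IsBackwardSolution A domA t xt (fun s => V t s xt)) ∧
  (∀ t, 0 ≤ t → ∀ xt ∈ Yreg t, ∀ u, IsBackwardSolution A domA t xt u →
    ∀ s ∈ Icc (0:ℝ) t, u s = V t s xt)

/-! ### `C₀`-semigroups and Kato's classes -/

/-- `T` is a strongly continuous one-parameter semigroup on `X`. -/
def IsC0Semigroup (T : ℝ → X →L[ℂ] X) : Prop :=
  T 0 = 1 ∧ (∀ s t : ℝ, 0 ≤ s → 0 ≤ t → T (s + t) = (T s).comp (T t)) ∧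
  ∀ x : X, ContinuousOn (fun t => T t x) (Ici (0:ℝ))

/-- `A` (with domain `domA`) is the generator of the `C₀`-semigroup `T`. -/
def IsGenerator (A : X →ₗ[ℂ] X) (domA : Submodule ℂ X) (T : ℝ → X →L[ℂ] X) : Prop :=
  IsC0Semigroup T ∧
  (∀ x : X, x ∈ domA ↔
    ∃ y, Tendsto (fun h : ℝ => h⁻¹ • (T h x - x)) (nhdsWithin 0 (Ioi 0)) (nhds y)) ∧
  (∀ x ∈ domA, Tendsto (fun h : ℝ => h⁻¹ • (T h x - x)) (nhdsWithin 0 (Ioi 0)) (nhds (A x)))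

/-- `A` generates a contraction `C₀`-semigroup on `X` (with respect to the given norm). -/
def GeneratesContractionSemigroup (A : X →ₗ[ℂ] X) (domA : Submodule ℂ X) : Prop :=
  ∃ T : ℝ → X →L[ℂ] X, IsGenerator A domA T ∧ ∀ t, 0 ≤ t → ‖T t‖ ≤ 1

/-- `A` generates a `C₀`-semigroup on `X` which is contractive with respect to the
(equivalent) norm `N`. -/
def GeneratesContractionSemigroupWrt (N : X → ℝ) (A : X →ₗ[ℂ] X) (domA : Submodule ℂ X) :
    Prop :=
  ∃ T : ℝ → X →L[ℂ] X, IsGenerator A domA T ∧ ∀ t, 0 ≤ t → ∀ x : X, N (T t x) ≤ N x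

/-- `N` is a norm on `X` which is equivalent to the original norm. -/
def IsEquivNorm (N : X → ℝ) : Prop :=
  (∀ x y : X, N (x + y) ≤ N x + N y) ∧ (∀ (c : ℂ) (x : X), N (c • x) = ‖c‖ * N x) ∧
  (∀ x : X, N x = 0 ↔ x = 0) ∧
  ∃ m M : ℝ, 0 < m ∧ 0 < M ∧ ∀ x : X, m * ‖x‖ ≤ N x ∧ N x ≤ M * ‖x‖

/-- The family `{A(t)}` is Kato-stable. -/
def KatoStable (A : ℝ → X →ₗ[ℂ] X) (domA : ℝ → Submodule ℂ X) : Prop :=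
  ∃ N : ℝ → X → ℝ,
    (∀ t, 0 ≤ t → IsEquivNorm (N t)) ∧
    (∀ T : ℝ, 0 ≤ T → ∃ c : ℝ, 0 ≤ c ∧ ∀ (x : X), ∀ s ∈ Icc (0:ℝ) T, ∀ t ∈ Icc (0:ℝ) T,
      |N t x - N s x| ≤ c * |t - s| * N s x) ∧
    (∀ t, 0 ≤ t → GeneratesContractionSemigroupWrt (N t) (A t) (domA t))

/-- The family `{A(t)}` belongs to the elementary Kato class: every `A(t)` generates a
contraction `C₀`-semigroup on `X`. -/
def ElementaryKatoClass (A : ℝ → X →ₗ[ℂ] X) (domA : ℝ → Submodule ℂ X) : Prop :=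
  ∀ t, 0 ≤ t → GeneratesContractionSemigroup (A t) (domA t)

/-- The family `{A(t)}` belongs to Kato's class: it is Kato-stable, the operators have the
common domain `D` and `A(·)` is strongly `C¹`. -/
def KatoClass (A : ℝ → X →ₗ[ℂ] X) (domA : ℝ → Submodule ℂ X) (D : Submodule ℂ X) : Prop :=
  KatoStable A domA ∧ (∀ t, 0 ≤ t → domA t = D) ∧
  ∀ x ∈ D, ContDiffOn ℝ 1 (fun t => A t x) (Ici (0:ℝ))

/-! ### Boundary control and observation systems -/

/-- Compatibility of the operator `B̃ ∈ L(U,X)` with the boundary control system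
`(𝔄, D(𝔄), 𝔅)`:  `B̃u ∈ D(𝔄)`, `𝔄B̃ ∈ L(U,X)` and `𝔅B̃u = u` for all `u ∈ U`. -/
def BtCompat (Af : X →ₗ[ℂ] X) (domA : Submodule ℂ X) (Bf : X →ₗ[ℂ] U)
    (Bt : U →L[ℂ] X) : Prop :=
  (∀ v : U, Bt v ∈ domA) ∧ (∃ c : ℝ, ∀ v : U, ‖Af (Bt v)‖ ≤ c * ‖v‖) ∧
  ∀ v : U, Bf (Bt v) = v

/-- `Σ(𝔄,𝔅,𝔆)` is a boundary control and observation (BCO) system: the main operator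
`A = 𝔄|_{D(𝔄) ∩ ker 𝔅}` generates a `C₀`-semigroup, there is a compatible `B̃ ∈ L(U,X)`,
and `𝔆` is bounded with respect to the graph norm of `𝔄`. -/
def IsBCO (Af : X →ₗ[ℂ] X) (domA : Submodule ℂ X) (Bf : X →ₗ[ℂ] U) (Cf : X →ₗ[ℂ] Y) :
    Prop :=
  (∃ T : ℝ → X →L[ℂ] X, IsGenerator Af (domA ⊓ LinearMap.ker Bf) T) ∧
  (∃ Bt : U →L[ℂ] X, BtCompat Af domA Bf Bt) ∧
  (∃ c : ℝ, ∀ x ∈ domA, ‖Cf x‖ ≤ c * (‖x‖ + ‖Af x‖))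

/-- A classical solution of the autonomous boundary control problem
`ẋ(t) = 𝔄x(t)`, `𝔅x(t) = u(t)`, `x(0) = x₀`. -/
def IsClassicalSolAut (Af : X →ₗ[ℂ] X) (domA : Submodule ℂ X) (Bf : X →ₗ[ℂ] U)
    (u : ℝ → U) (x₀ : X) (x : ℝ → X) : Prop :=
  x 0 = x₀ ∧ (∀ t, (0:ℝ) ≤ t → x t ∈ domA) ∧
  (∀ t, (0:ℝ) ≤ t → HasDerivWithinAt x (Af (x t)) (Ici (0:ℝ)) t) ∧
  ContinuousOn (fun t => Af (x t)) (Ici (0:ℝ)) ∧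
  ∀ t, (0:ℝ) ≤ t → Bf (x t) = u t

/-- A classical solution pair `(x,y)` of the autonomous BCO system. -/
def IsClassicalSolPairAut (Af : X →ₗ[ℂ] X) (domA : Submodule ℂ X) (Bf : X →ₗ[ℂ] U)
    (Cf : X →ₗ[ℂ] Y) (u : ℝ → U) (x₀ : X) (x : ℝ → X) (y : ℝ → Y) : Prop :=
  IsClassicalSolAut Af domA Bf u x₀ x ∧ ContinuousOn y (Ici (0:ℝ)) ∧
  ∀ t, (0:ℝ) ≤ t → y t = Cf (x t)

/-- A classical solution of the non-autonomous boundary control problem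
`ẋ(t) = 𝔄(t)x(t)`, `𝔅(t)x(t) = u(t)`, `x(s) = xs` on `[s,∞)`. -/
def IsClassicalSolN (Af : ℝ → X →ₗ[ℂ] X) (domA : ℝ → Submodule ℂ X)
    (Bf : ℝ → X →ₗ[ℂ] U) (u : ℝ → U) (s : ℝ) (xs : X) (x : ℝ → X) : Prop :=
  x s = xs ∧ (∀ t, s ≤ t → x t ∈ domA t) ∧
  (∀ t, s ≤ t → HasDerivWithinAt x (Af t (x t)) (Ici s) t) ∧
  ContinuousOn (fun t => Af t (x t)) (Ici s) ∧
  ∀ t, s ≤ t → Bf t (x t) = u t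

/-- A classical solution pair `(x,y)` of the non-autonomous BCO system. -/
def IsClassicalSolPairN (Af : ℝ → X →ₗ[ℂ] X) (domA : ℝ → Submodule ℂ X)
    (Bf : ℝ → X →ₗ[ℂ] U) (Cf : ℝ → X →ₗ[ℂ] Y)
    (u : ℝ → U) (s : ℝ) (xs : X) (x : ℝ → X) (y : ℝ → Y) : Prop :=
  IsClassicalSolN Af domA Bf u s xs x ∧ ContinuousOn y (Ici s) ∧
  ∀ t, s ≤ t → y t = Cf t (x t)

/-- `Σ_N(𝔄,𝔅,𝔆)` is a non-autonomous boundary control and observation (NBCO) system: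
each frozen-time system is a BCO system and the family of main operators generates the
evolution family `W` with regularity spaces `Yreg`. -/
def IsNBCO (Af : ℝ → X →ₗ[ℂ] X) (domA : ℝ → Submodule ℂ X) (Bf : ℝ → X →ₗ[ℂ] U)
    (Cf : ℝ → X →ₗ[ℂ] Y) (W : ℝ → ℝ → X →L[ℂ] X) (Yreg : ℝ → Submodule ℂ X) : Prop :=
  (∀ t, 0 ≤ t → IsBCO (Af t) (domA t) (Bf t) (Cf t)) ∧
  Generates Af (fun t => domA t ⊓ LinearMap.ker (Bf t)) W Yreg

/-- Well-posedness of the non-autonomous BCO system. -/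
def WellPosedN (Af : ℝ → X →ₗ[ℂ] X) (domA : ℝ → Submodule ℂ X) (Bf : ℝ → X →ₗ[ℂ] U)
    (Cf : ℝ → X →ₗ[ℂ] Y) : Prop :=
  ∀ τ : ℝ, 0 < τ → ∃ m : ℝ, 0 < m ∧ ∀ s, 0 ≤ s → s ≤ τ →
    ∀ (u : ℝ → U) (xs : X) (x : ℝ → X) (y : ℝ → Y),
      IsClassicalSolPairN Af domA Bf Cf u s xs x y →
      ‖x τ‖ ^ 2 + ∫ r in s..τ, ‖y r‖ ^ 2 ≤ m * (‖xs‖ ^ 2 + ∫ r in s..τ, ‖u r‖ ^ 2)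

/-- `u ∈ L²_loc([0,∞); V)`. -/
def L2loc {V : Type*} [NormedAddCommGroup V] (u : ℝ → V) : Prop :=
  ∀ T : ℝ, 0 < T →
    AEStronglyMeasurable u (volume.restrict (Icc (0:ℝ) T)) ∧
    IntegrableOn (fun r => ‖u r‖ ^ 2) (Icc (0:ℝ) T)

end NormedDefs

/-! ### Hilbert space notions -/

section HilbertDefs

variable {X U Y V : Type*}
variable [NormedAddCommGroup X] [InnerProductSpace ℂ X]
variable [NormedAddCommGroup U] [InnerProductSpace ℂ U]
variable [NormedAddCommGroup Y] [InnerProductSpace ℂ Y]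
variable [NormedAddCommGroup V] [InnerProductSpace ℂ V]

/-- A family of bounded operators each of which is self-adjoint. -/
def SelfAdjointFamily (M : ℝ → V →L[ℂ] V) : Prop :=
  ∀ t, 0 ≤ t → ∀ x y : V, ⟪M t x, y⟫ = ⟪x, M t y⟫

/-- A uniformly coercive family of bounded operators. -/
def UniformlyCoercive (M : ℝ → V →L[ℂ] V) : Prop :=
  ∃ β : ℝ, 0 < β ∧ ∀ t, 0 ≤ t → ∀ x : V, β * ‖x‖ ^ 2 ≤ (⟪M t x, x⟫).re

/-- `B` (with domain `domB`) is the adjoint of the (densely defined) operator `A`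
(with domain `domA`). -/
def IsAdjointOp (A : X →ₗ[ℂ] X) (domA : Submodule ℂ X) (B : X →ₗ[ℂ] X)
    (domB : Submodule ℂ X) : Prop :=
  (∀ y ∈ domB, ∀ x ∈ domA, ⟪B y, x⟫ = ⟪y, A x⟫) ∧
  (∀ y z : X, (∀ x ∈ domA, ⟪z, x⟫ = ⟪y, A x⟫) → y ∈ domB ∧ z = B y)

/-- The autonomous BCO system `Σ(𝔄,𝔅,𝔆)` is `(P,R,J)`-scattering passive. -/
def ScatteringPassive (Af : X →ₗ[ℂ] X) (domA : Submodule ℂ X) (Bf : X →ₗ[ℂ] U)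
    (Cf : X →ₗ[ℂ] Y) (P : X →L[ℂ] X) (R : U →L[ℂ] U) (J : Y →L[ℂ] Y) : Prop :=
  ∀ (u : ℝ → U) (x₀ : X) (x : ℝ → X) (y : ℝ → Y),
    IsClassicalSolPairAut Af domA Bf Cf u x₀ x y →
    ∀ t, (0:ℝ) ≤ t → ∀ d : ℝ,
      HasDerivWithinAt (fun τ => (⟪P (x τ), x τ⟫).re) d (Ici (0:ℝ)) t →
      d ≤ (⟪R (u t), u t⟫).re - (⟪y t, J (y t)⟫).re

/-- The autonomous BCO system `Σ(𝔄,𝔅,𝔆)` is `(P,R,J)`-scattering energy preserving. -/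
def ScatteringEnergyPreserving (Af : X →ₗ[ℂ] X) (domA : Submodule ℂ X) (Bf : X →ₗ[ℂ] U)
    (Cf : X →ₗ[ℂ] Y) (P : X →L[ℂ] X) (R : U →L[ℂ] U) (J : Y →L[ℂ] Y) : Prop :=
  ∀ (u : ℝ → U) (x₀ : X) (x : ℝ → X) (y : ℝ → Y),
    IsClassicalSolPairAut Af domA Bf Cf u x₀ x y →
    ∀ t, (0:ℝ) ≤ t → ∀ d : ℝ,
      HasDerivWithinAt (fun τ => (⟪P (x τ), x τ⟫).re) d (Ici (0:ℝ)) t →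
      d = (⟪R (u t), u t⟫).re - (⟪y t, J (y t)⟫).re

/-- The non-autonomous BCO system `Σ_N(𝔄,𝔅,𝔆)` is `(R,P,J)`-scattering passive;
here `P'` is the strong derivative of `P`. -/
def NScatteringPassive (Af : ℝ → X →ₗ[ℂ] X) (domA : ℝ → Submodule ℂ X)
    (Bf : ℝ → X →ₗ[ℂ] U) (Cf : ℝ → X →ₗ[ℂ] Y)
    (R : ℝ → U →L[ℂ] U) (P P' : ℝ → X →L[ℂ] X) (J : ℝ → Y →L[ℂ] Y) : Prop :=
  ∀ s, (0:ℝ) ≤ s → ∀ (u : ℝ → U) (xs : X) (x : ℝ → X) (y : ℝ → Y),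
    IsClassicalSolPairN Af domA Bf Cf u s xs x y →
    ∀ t, s ≤ t → ∀ d : ℝ,
      HasDerivWithinAt (fun τ => (⟪P τ (x τ), x τ⟫).re) d (Ici s) t →
      d + (⟪y t, J t (y t)⟫).re ≤ (⟪u t, R t (u t)⟫).re + (⟪P' t (x t), x t⟫).re

/-- The pointwise characterization of `(R,P,J)`-scattering passivity of the non-autonomous
BCO system on the admissible spaces `𝒱(t)`. -/
def NScatteringPassivePointwise (Af : ℝ → X →ₗ[ℂ] X) (domA : ℝ → Submodule ℂ X)
    (Bf : ℝ → X →ₗ[ℂ] U) (Cf : ℝ → X →ₗ[ℂ] Y)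
    (R : ℝ → U →L[ℂ] U) (P : ℝ → X →L[ℂ] X) (J : ℝ → Y →L[ℂ] Y) : Prop :=
  ∀ t, (0:ℝ) ≤ t → ∀ (x : X) (u : U), x ∈ domA t → Bf t x = u →
    2 * (⟪Af t x, P t x⟫).re ≤ (⟪R t u, Bf t x⟫).re - (⟪Cf t x, J t (Cf t x)⟫).re

end HilbertDefs

end NBCS

set_option linter.unusedSectionVars false
set_option linter.deprecated false
set_option linter.unusedVariables false

namespace KP
open Topology

section Generic
variable {X : Type*} [NormedAddCommGroup X] [NormedSpace ℂ X]

lemma map_real_smul (G : X →L[ℂ] X) (r : ℝ) (x : X) : G (r • x) = r • G x :=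
  ContinuousLinearMap.map_smul_of_tower G r x

lemma rd_iff {f : ℝ → X} {f' : X} {t : ℝ} :
    HasDerivWithinAt f f' (Ici t) t ↔
      Tendsto (fun h : ℝ => h⁻¹ • (f (t + h) - f t)) (𝓝[>] 0) (𝓝 f') := by
  rw [← hasDerivWithinAt_Ioi_iff_Ici, hasDerivWithinAt_iff_tendsto_slope]
  have h1 : Ioi t \ {t} = Ioi t := by
    ext x; simp
  rw [h1]
  have h2 : 𝓝[>] t = map (fun h => t + h) (𝓝[>] (0:ℝ)) := by
    rw [map_add_left_nhdsGT]; simp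
  rw [h2, tendsto_map'_iff]
  apply Eq.to_iff
  congr 1
  funext h
  simp [slope, Function.comp]

variable [CompleteSpace X]

/-- Strong convergence of operators together with convergence of vectors. -/
lemma tendsto_apply {α : Type*} {l : Filter α} [l.IsCountablyGenerated]
    {G : α → X →L[ℂ] X} {G0 : X →L[ℂ] X} {w : α → X} {w0 : X}
    (hG : ∀ x, Tendsto (fun i => G i x) l (𝓝 (G0 x))) (hw : Tendsto w l (𝓝 w0)) :
    Tendsto (fun i => G i (w i)) l (𝓝 (G0 w0)) := by
  rw [tendsto_iff_seq_tendsto]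
  intro p hp
  have hG' : ∀ x, Tendsto (fun n => G (p n) x) atTop (𝓝 (G0 x)) := fun x => (hG x).comp hp
  obtain ⟨C, hC⟩ : ∃ C, ∀ n, ‖G (p n)‖ ≤ C := by
    apply banach_steinhaus
    intro x
    obtain ⟨C, hC⟩ := ((hG' x).norm.bddAbove_range)
    exact ⟨C, fun n => hC ⟨n, rfl⟩⟩
  have h1 : Tendsto (fun n => G (p n) (w (p n) - w0)) atTop (𝓝 0) := by
    have h2 : Tendsto (fun n => C * ‖w (p n) - w0‖) atTop (𝓝 0) := by
      have := ((hw.comp hp).sub_const w0).norm.const_mul C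
      simpa using this
    refine squeeze_zero_norm (fun n => ?_) h2
    exact (G (p n)).le_of_opNorm_le (hC n) _
  have := h1.add (hG' w0)
  simpa [Function.comp_def] using this

lemma continuousOn_apply {α : Type*} [TopologicalSpace α] [FirstCountableTopology α] {S : Set α}
    {G : α → X →L[ℂ] X} {w : α → X}
    (hG : ∀ x, ContinuousOn (fun i => G i x) S) (hw : ContinuousOn w S) :
    ContinuousOn (fun i => G i (w i)) S :=
  fun p hp => tendsto_apply (fun x => hG x p hp) (hw p hp)

lemma continuous_apply' {α : Type*} [TopologicalSpace α] [FirstCountableTopology α]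
    {G : α → X →L[ℂ] X} {w : α → X}
    (hG : ∀ x, Continuous (fun i => G i x)) (hw : Continuous w) :
    Continuous (fun i => G i (w i)) := by
  rw [← continuousOn_univ]
  exact continuousOn_apply (fun x => (hG x).continuousOn) hw.continuousOn

lemma bdd_of_compact {α : Type*} [TopologicalSpace α] {S : Set α} (hS : IsCompact S)
    {G : α → X →L[ℂ] X} (hG : ∀ x, ContinuousOn (fun i => G i x) S) :
    ∃ C, 0 ≤ C ∧ ∀ p ∈ S, ‖G p‖ ≤ C := by
  obtain ⟨C, hC⟩ : ∃ C, ∀ p : S, ‖G p‖ ≤ C := by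
    apply banach_steinhaus
    intro x
    obtain ⟨C, hC⟩ := hS.exists_bound_of_continuousOn (hG x)
    exact ⟨C, fun p => hC p p.2⟩
  exact ⟨max C 0, le_max_right _ _, fun p hp => (hC ⟨p, hp⟩).trans (le_max_left _ _)⟩

/-- strong product rule for right derivatives -/
lemma rd_apply {G : ℝ → X →L[ℂ] X} {G' : X →L[ℂ] X} {w : ℝ → X} {w' : X} {t : ℝ}
    (hc : ∀ x, ContinuousWithinAt (fun r => G r x) (Ici t) t)
    (hG : HasDerivWithinAt (fun r => G r (w t)) (G' (w t)) (Ici t) t)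
    (hw : HasDerivWithinAt w w' (Ici t) t) :
    HasDerivWithinAt (fun r => G r (w r)) (G' (w t) + G t w') (Ici t) t := by
  rw [rd_iff] at *
  have hsh : Tendsto (fun h : ℝ => t + h) (𝓝[>] 0) (𝓝[≥] t) := by
    have h2 : 𝓝[>] t = map (fun h => t + h) (𝓝[>] (0:ℝ)) := by
      rw [map_add_left_nhdsGT]; simp
    rw [tendsto_iff_comap, ← map_le_iff_le_comap, ← h2]
    exact nhdsWithin_mono _ Ioi_subset_Ici_self
  have h1 := tendsto_apply (G := fun h => G (t + h)) (G0 := G t)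
    (fun x => (hc x).tendsto.comp hsh) hw
  refine (hG.add h1).congr (fun h => ?_)
  simp only [map_real_smul, map_sub, ← smul_add]
  congr 1
  abel

/-- Tendsto of uniformly bounded operators on a dense set. -/
lemma tendsto_of_dense {α : Type*} {l : Filter α} {B : α → X →L[ℂ] X} {B0 : X →L[ℂ] X} {C : ℝ}
    (hB : ∀ᶠ i in l, ‖B i‖ ≤ C) {S : Set X} (hS : Dense S)
    (h : ∀ x ∈ S, Tendsto (fun i => B i x) l (𝓝 (B0 x))) (x : X) :
    Tendsto (fun i => B i x) l (𝓝 (B0 x)) := by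
  rw [Metric.tendsto_nhds]
  intro ε hε
  set C' := |C| + ‖B0‖ + 1 with hC'
  have hC'pos : 0 < C' := by positivity
  obtain ⟨y, hyS, hy⟩ := hS.exists_dist_lt x (show 0 < ε / (2 * C') by positivity)
  filter_upwards [hB, (Metric.tendsto_nhds.1 (h y hyS)) (ε/2) (by positivity)] with i hi hi2
  have h1 : B i x - B0 x = B i (x - y) - B0 (x - y) + (B i y - B0 y) := by
    simp only [map_sub]; abel
  rw [dist_eq_norm] at *
  rw [h1]
  have h2 : ‖B i (x - y)‖ ≤ |C| * ‖x - y‖ := (B i).le_of_opNorm_le (hi.trans (le_abs_self C)) _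
  have h3 : ‖B0 (x - y)‖ ≤ ‖B0‖ * ‖x - y‖ := B0.le_opNorm _
  have h4 : C' * ‖x - y‖ < ε / 2 := by
    calc C' * ‖x - y‖ < C' * (ε / (2 * C')) := by gcongr
      _ = ε / 2 := by field_simp
  have h5 := norm_add_le (B i (x - y) - B0 (x - y)) (B i y - B0 y)
  have h6 := norm_sub_le (B i (x - y)) (B0 (x - y))
  have : 0 ≤ ‖x - y‖ := norm_nonneg _
  nlinarith

structure SC1 (T : ℝ) (G G' : ℝ → X →L[ℂ] X) : Prop where
  cont : ∀ x, ContinuousOn (fun t => G t x) (Icc 0 T)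
  cont' : ∀ x, ContinuousOn (fun t => G' t x) (Icc 0 T)
  rd : ∀ x, ∀ t ∈ Ico 0 T, HasDerivWithinAt (fun t => G t x) (G' t x) (Ici t) t

lemma cwa_Ici_of_Icc {E : Type*} [TopologicalSpace E] {f : ℝ → E} {s T t : ℝ}
    (h : ContinuousOn f (Icc s T)) (ht : t ∈ Ico s T) : ContinuousWithinAt f (Ici t) t := by
  have h1 := (h t ⟨ht.1, ht.2.le⟩)
  have h2 : Icc t T ∈ 𝓝[≥] t := Icc_mem_nhdsGE ht.2
  exact (h1.mono (Icc_subset_Icc_left ht.1)).mono_of_mem_nhdsWithin h2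

namespace SC1
variable {T : ℝ} {G G' H H' : ℝ → X →L[ℂ] X}

lemma cwa (h : SC1 T G G') {t : ℝ} (ht : t ∈ Ico 0 T) (x : X) :
    ContinuousWithinAt (fun r => G r x) (Ici t) t :=
  cwa_Ici_of_Icc (h.cont x) ht

lemma rd_apply (h : SC1 T G G') {w : ℝ → X} {w' : X} {t : ℝ} (ht : t ∈ Ico 0 T)
    (hw : HasDerivWithinAt w w' (Ici t) t) :
    HasDerivWithinAt (fun r => G r (w r)) (G' t (w t) + G t w') (Ici t) t :=
  KP.rd_apply (h.cwa ht) (h.rd _ t ht) hw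

lemma lip (h : SC1 T G G') : ∃ C, 0 ≤ C ∧ ∀ s ∈ Icc 0 T, ∀ t ∈ Icc 0 T,
    ‖G t - G s‖ ≤ C * |t - s| := by
  obtain ⟨C, hC0, hC⟩ := bdd_of_compact isCompact_Icc h.cont'
  have key : ∀ s ∈ Icc 0 T, ∀ t ∈ Icc 0 T, s ≤ t → ‖G t - G s‖ ≤ C * |t - s| := by
    intro s hs t ht hst
    refine ContinuousLinearMap.opNorm_le_bound _ (by positivity) (fun x => ?_)
    have := norm_image_sub_le_of_norm_deriv_right_le_segment (f := fun r => G r x)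
      (f' := fun r => G' r x) (C := C * ‖x‖) (a := s) (b := t)
      ((h.cont x).mono (Icc_subset_Icc hs.1 ht.2))
      (fun r hr => h.rd x r ⟨hs.1.trans hr.1, hr.2.trans_le ht.2⟩)
      (fun r hr => (G' r).le_of_opNorm_le (hC r ⟨hs.1.trans hr.1, hr.2.le.trans ht.2⟩) _)
      t (right_mem_Icc.2 hst)
    rw [abs_of_nonneg (by linarith)]
    simp only [ContinuousLinearMap.sub_apply]
    linarith
  refine ⟨C, hC0, fun s hs t ht => ?_⟩
  rcases le_total s t with hst | hst
  · exact key s hs t ht hst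
  · rw [norm_sub_rev, abs_sub_comm]; exact key t ht s hs hst

lemma normCont (h : SC1 T G G') : ContinuousOn G (Icc 0 T) := by
  obtain ⟨C, hC0, hC⟩ := h.lip
  have : LipschitzOnWith (Real.toNNReal C) G (Icc 0 T) := by
    apply LipschitzOnWith.of_dist_le_mul
    intro x hx y hy
    rw [dist_eq_norm, dist_eq_norm, Real.norm_eq_abs, Real.coe_toNNReal C hC0]
    exact hC y hy x hx
  exact this.continuousOn

lemma add (h : SC1 T G G') (k : SC1 T H H') : SC1 T (fun t => G t + H t) (fun t => G' t + H' t) :=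
  ⟨fun x => (h.cont x).add (k.cont x), fun x => (h.cont' x).add (k.cont' x),
    fun x t ht => (h.rd x t ht).add (k.rd x t ht)⟩

lemma sub (h : SC1 T G G') (k : SC1 T H H') : SC1 T (fun t => G t - H t) (fun t => G' t - H' t) :=
  ⟨fun x => (h.cont x).sub (k.cont x), fun x => (h.cont' x).sub (k.cont' x),
    fun x t ht => (h.rd x t ht).sub (k.rd x t ht)⟩

lemma const (T : ℝ) (G : X →L[ℂ] X) : SC1 T (fun _ => G) (fun _ => 0) :=
  ⟨fun x => continuousOn_const, fun x => continuousOn_const,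
    fun x t ht => by simpa using hasDerivWithinAt_const _ _ _⟩

lemma comp (h : SC1 T G G') (k : SC1 T H H') :
    SC1 T (fun t => (G t).comp (H t)) (fun t => (G' t).comp (H t) + (G t).comp (H' t)) :=
  ⟨fun x => continuousOn_apply (G := G) h.cont (k.cont x),
   fun x => (continuousOn_apply (G := G') h.cont' (k.cont x)).add
    (continuousOn_apply (G := G) h.cont (k.cont' x)),
   fun x t ht => by
    have := h.rd_apply ht (k.rd x t ht)
    simpa using this⟩

lemma inv (h : SC1 T G G') (hu : ∀ t ∈ Icc 0 T, IsUnit (G t)) :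
    SC1 T (fun t => Ring.inverse (G t))
      (fun t => - (Ring.inverse (G t)).comp ((G' t).comp (Ring.inverse (G t)))) := by
  have c1 : ContinuousOn (fun t => Ring.inverse (G t)) (Icc 0 T) := by
    intro t ht
    obtain ⟨u, hu⟩ := hu t ht
    have := NormedRing.inverse_continuousAt u
    rw [hu] at this
    exact this.comp_continuousWithinAt (h.normCont t ht)
  have c2 : ∀ x, ContinuousOn (fun t => Ring.inverse (G t) x) (Icc 0 T) :=
    fun x => c1.clm_apply continuousOn_const
  refine ⟨c2, fun x => ?_, fun x t ht => ?_⟩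
  · exact (continuousOn_apply c2 (continuousOn_apply h.cont' (c2 x))).neg
  · have ht' : t ∈ Icc 0 T := ⟨ht.1, ht.2.le⟩
    have h1 := h.rd (Ring.inverse (G t) x) t ht
    rw [rd_iff] at h1 ⊢
    have hsh : Tendsto (fun h : ℝ => t + h) (𝓝[>] 0) (𝓝[≥] t) := by
      have h2 : 𝓝[>] t = map (fun h => t + h) (𝓝[>] (0:ℝ)) := by
        rw [map_add_left_nhdsGT]; simp
      rw [tendsto_iff_comap, ← map_le_iff_le_comap, ← h2]
      exact nhdsWithin_mono _ Ioi_subset_Ici_self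
    have h2 := tendsto_apply (G := fun h => Ring.inverse (G (t + h))) (G0 := Ring.inverse (G t))
      (fun y => (cwa_Ici_of_Icc (c2 y) ht).tendsto.comp hsh) h1
    refine h2.neg.congr' ?_
    have hev : ∀ᶠ h in 𝓝[>] (0:ℝ), h < T - t :=
      nhdsWithin_le_nhds (gt_mem_nhds (by linarith [ht.2]))
    filter_upwards [hev, self_mem_nhdsWithin] with r hr hr0
    have hr0' : 0 < r := hr0
    have hm : t + r ∈ Icc 0 T := ⟨by linarith [ht.1], by linarith⟩
    have e1 : Ring.inverse (G (t + r)) (G (t + r) (Ring.inverse (G t) x)) = Ring.inverse (G t) x := by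
      rw [← ContinuousLinearMap.mul_apply, Ring.inverse_mul_cancel _ (hu _ hm)]; rfl
    have e2 : G t (Ring.inverse (G t) x) = x := by
      rw [← ContinuousLinearMap.mul_apply, Ring.mul_inverse_cancel _ (hu _ ht')]; rfl
    rw [map_real_smul, map_sub, e1, e2, ← smul_neg, neg_sub]

end SC1

/-- From strong `C¹` to `SC1`. -/
lemma sc1_of_contDiffOn {G : ℝ → X →L[ℂ] X}
    (hG : ∀ x, ContDiffOn ℝ 1 (fun t => G t x) (Ici (0:ℝ))) :
    ∃ G' : ℝ → X →L[ℂ] X, (∀ T, SC1 T G G') ∧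
      ∀ x, ∀ t ∈ Ici (0:ℝ), G' t x = derivWithin (fun t => G t x) (Ici 0) t := by
  have hd : ∀ x, ∀ t ∈ Ici (0:ℝ), HasDerivWithinAt (fun t => G t x)
      (derivWithin (fun t => G t x) (Ici 0) t) (Ici t) t := by
    intro x t ht
    exact (((hG x).differentiableOn (by simp)) t ht).hasDerivWithinAt.mono (Ici_subset_Ici.2 ht)
  have hex : ∀ t ∈ Ici (0:ℝ), ∃ L : X →L[ℂ] X,
      ∀ x, L x = derivWithin (fun t => G t x) (Ici 0) t := by
    intro t ht
    have hseq : Tendsto (fun n : ℕ => 1 / ((n:ℝ) + 1)) atTop (𝓝[>] 0) := by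
      rw [tendsto_nhdsWithin_iff]
      exact ⟨tendsto_one_div_add_atTop_nhds_zero_nat, Eventually.of_forall fun n => by
        simp only [mem_Ioi]; positivity⟩
    let g : ℕ → X →L[ℂ] X := fun n =>
      (((1 / ((n:ℝ) + 1))⁻¹ : ℝ) : ℂ) • (G (t + 1 / ((n:ℝ) + 1)) - G t)
    have hg : Tendsto (fun n x => g n x) atTop
        (𝓝 (fun x => derivWithin (fun t => G t x) (Ici 0) t)) := by
      rw [tendsto_pi_nhds]
      intro x
      refine ((rd_iff.1 (hd x t ht)).comp hseq).congr (fun n => ?_)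
      simp only [g, Function.comp, ContinuousLinearMap.smul_apply, ContinuousLinearMap.sub_apply]
      rw [Complex.coe_smul]
    exact ⟨continuousLinearMapOfTendsto g hg, fun x => rfl⟩
  choose! G' hG' using hex
  refine ⟨G', fun T => ⟨fun x => ?_, fun x => ?_, fun x t ht => ?_⟩, fun x t ht => hG' t ht x⟩
  · exact (hG x).continuousOn.mono Icc_subset_Ici_self
  · have := ((hG x).continuousOn_derivWithin (uniqueDiffOn_Ici 0) (by simp)).mono
      (show Icc (0:ℝ) T ⊆ Ici 0 from Icc_subset_Ici_self)
    refine this.congr (fun t ht => hG' t ht.1 x)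
  · have := hd x t ht.1
    rwa [← hG' t ht.1] at this

end Generic
end KP

set_option linter.unusedSectionVars false
set_option linter.deprecated false
set_option linter.unusedVariables false

namespace KP
open Topology

section Gen
variable {X : Type*} [NormedAddCommGroup X] [NormedSpace ℂ X] [CompleteSpace X]
variable {A : X →ₗ[ℂ] X} {D : Submodule ℂ X} {T : ℝ → X →L[ℂ] X}

lemma gen_comm (hg : NBCS.IsGenerator A D T) {x : X} (hx : x ∈ D) {h : ℝ} (hh : 0 ≤ h) :
    T h x ∈ D ∧ A (T h x) = T h (A x) := by
  have h1 : Tendsto (fun e : ℝ => e⁻¹ • (T e (T h x) - T h x)) (𝓝[>] 0) (𝓝 (T h (A x))) := by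
    have h2 := (((T h).continuous.tendsto _).comp (hg.2.2 x hx))
    refine h2.congr' ?_
    filter_upwards [self_mem_nhdsWithin] with e he
    have he' : (0:ℝ) ≤ e := le_of_lt he
    have e1 : T e (T h x) = T h (T e x) := by
      rw [← ContinuousLinearMap.comp_apply, ← ContinuousLinearMap.comp_apply,
        ← hg.1.2.1 e h he' hh, ← hg.1.2.1 h e hh he', add_comm]
    simp only [Function.comp, map_real_smul, map_sub, e1]
  have hm : T h x ∈ D := (hg.2.1 _).2 ⟨_, h1⟩
  exact ⟨hm, tendsto_nhds_unique (hg.2.2 _ hm) h1⟩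

lemma gen_rd (hg : NBCS.IsGenerator A D T) {x : X} (hx : x ∈ D) {h : ℝ} (hh : 0 ≤ h) :
    HasDerivWithinAt (fun r => T r x) (A (T h x)) (Ici h) h := by
  rw [rd_iff]
  obtain ⟨h1, h2⟩ := gen_comm hg hx hh
  refine (hg.2.2 _ h1).congr' ?_
  filter_upwards [self_mem_nhdsWithin] with e he
  have he' : (0:ℝ) ≤ e := le_of_lt he
  rw [add_comm h e, hg.1.2.1 e h he' hh]; rfl

lemma gen_resolvent (hg : NBCS.IsGenerator A D T) {C : ℝ} (hC : ∀ h, 0 ≤ h → ‖T h‖ ≤ C)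
    {μ : ℝ} (hμ : 0 < μ) :
    ∃ R : X →L[ℂ] X, (∀ x, R x ∈ D) ∧ (∀ x, μ • R x - A (R x) = x) ∧
      (∀ x ∈ D, R (μ • x - A x) = x) ∧ ‖R‖ ≤ C / μ ∧
      (∀ x, ∀ h, 0 ≤ h → T h (R x) =
        Real.exp (μ * h) • (R x - ∫ r in (0:ℝ)..h, Real.exp (-μ * r) • T r x)) := by
  have hC0 : 0 ≤ C := (norm_nonneg _).trans (hC 0 le_rfl)
  have hcont : ∀ x, ContinuousOn (fun r => Real.exp (-μ * r) • T r x) (Ici 0) := fun x =>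
    ((show Continuous (fun r : ℝ => Real.exp (-μ * r)) by fun_prop).continuousOn).smul (hg.1.2.2 x)
  have hexp := integrableOn_exp_mul_Ioi (neg_lt_zero.2 hμ) 0
  have hbd : ∀ x, ∀ r ∈ Ioi (0:ℝ), ‖Real.exp (-μ * r) • T r x‖ ≤ (C * ‖x‖) * Real.exp (-μ * r) := by
    intro x r hr
    rw [norm_smul, Real.norm_eq_abs, Real.abs_exp, mul_comm]
    gcongr
    exact (T r).le_of_opNorm_le (hC r (le_of_lt hr)) x
  have hIntg : ∀ x, IntegrableOn (fun r => Real.exp (-μ * r) • T r x) (Ioi 0) := by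
    intro x
    refine Integrable.mono' (hexp.const_mul (C * ‖x‖)) ?_ ?_
    · exact ((hcont x).mono Ioi_subset_Ici_self).aestronglyMeasurable measurableSet_Ioi
    · exact (ae_restrict_iff' measurableSet_Ioi).2 (Eventually.of_forall (hbd x))
  let R0 : X →ₗ[ℂ] X :=
    { toFun := fun x => ∫ r in Ioi (0:ℝ), Real.exp (-μ * r) • T r x
      map_add' := fun x y => by
        simp only [map_add, smul_add]
        exact integral_add (hIntg x) (hIntg y)
      map_smul' := fun c x => by
        simp only [map_smul, RingHom.id_apply]
        rw [← integral_smul]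
        congr 1; funext r; rw [smul_comm] }
  have hR0 : ∀ x, ‖R0 x‖ ≤ (C / μ) * ‖x‖ := by
    intro x
    have h1 := norm_integral_le_of_norm_le (hexp.const_mul (C * ‖x‖))
      ((ae_restrict_iff' measurableSet_Ioi).2 (Eventually.of_forall (hbd x)))
    rw [integral_const_mul, integral_exp_mul_Ioi (neg_lt_zero.2 hμ)] at h1
    refine h1.trans (le_of_eq ?_)
    simp; field_simp
  let R : X →L[ℂ] X := R0.mkContinuous (C / μ) hR0
  have hRdef : ∀ x, R x = ∫ r in Ioi (0:ℝ), Real.exp (-μ * r) • T r x := fun x => rfl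
  have hcomm : ∀ x h, 0 ≤ h → T h (R x) = ∫ r in Ioi (0:ℝ), Real.exp (-μ * r) • T (r + h) x := by
    intro x h hh
    rw [hRdef, ← ContinuousLinearMap.integral_comp_comm _ (hIntg x)]
    refine setIntegral_congr_fun measurableSet_Ioi (fun r hr => ?_)
    simp only [map_real_smul]
    rw [add_comm r h, hg.1.2.1 h r hh (le_of_lt hr)]; rfl
  have hcomm2 : ∀ x h, 0 ≤ h → T h (R x) = R (T h x) := by
    intro x h hh
    rw [hcomm x h hh, hRdef]
    refine setIntegral_congr_fun measurableSet_Ioi (fun r hr => ?_)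
    rw [hg.1.2.1 r h (le_of_lt hr) hh]; rfl
  have hform : ∀ x h, 0 ≤ h → T h (R x) =
      Real.exp (μ * h) • (R x - ∫ r in (0:ℝ)..h, Real.exp (-μ * r) • T r x) := by
    intro x h hh
    have h1 : R x - ∫ r in (0:ℝ)..h, Real.exp (-μ * r) • T r x
        = ∫ r in Ioi h, Real.exp (-μ * r) • T r x := by
      rw [hRdef, ← intervalIntegral.integral_Ioi_sub_Ioi (hIntg x) hh]; abel
    have h2 := (measurePreserving_add_right (volume : Measure ℝ) h).setIntegral_preimage_emb
      (measurableEmbedding_addRight h) (fun r => Real.exp (-μ * r) • T r x) (Ioi h)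
    rw [h1, ← h2, ← integral_smul, hcomm x h hh]
    simp only [preimage_add_const_Ioi, sub_self]
    refine setIntegral_congr_fun measurableSet_Ioi (fun r hr => ?_)
    rw [smul_smul, ← Real.exp_add]
    congr 2; ring
  have hder : ∀ x, Tendsto (fun h : ℝ => h⁻¹ • (T h (R x) - R x)) (𝓝[>] 0)
      (𝓝 (μ • R x - x)) := by
    intro x
    have hT0 : T 0 = 1 := hg.1.1
    have h1 : HasDerivWithinAt (fun u => ∫ r in (0:ℝ)..u, Real.exp (-μ * r) • T r x)
        (Real.exp (-μ * 0) • T 0 x) (Ici 0) 0 := by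
      refine intervalIntegral.integral_hasDerivWithinAt_right (by simp) (t := Ioi 0) ?_ ?_
      · exact ⟨Ioi 0, self_mem_nhdsWithin,
          ((hcont x).mono Ioi_subset_Ici_self).aestronglyMeasurable measurableSet_Ioi⟩
      · exact ((hcont x) 0 self_mem_Ici).mono Ioi_subset_Ici_self
    have h2 : HasDerivWithinAt (fun u : ℝ => Real.exp (μ * u)) (μ) (Ici 0) 0 := by
      have : HasDerivAt (fun u : ℝ => Real.exp (μ * u)) (Real.exp (μ * 0) * (μ * 1)) 0 :=
        ((hasDerivAt_id (0:ℝ)).const_mul μ).exp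
      simpa using this.hasDerivWithinAt
    have h3 := h2.smul (h1.const_sub (R x))
    rw [rd_iff] at h3
    have e : μ • R x - x = Real.exp (μ * 0) • -(Real.exp (-μ * 0) • (T 0) x) +
        μ • (R x - ∫ r in (0:ℝ)..0, Real.exp (-μ * r) • (T r) x) := by
      simp [hT0]; abel
    rw [e]
    refine h3.congr' ?_
    filter_upwards [self_mem_nhdsWithin] with r hr
    rw [hform x r (le_of_lt hr)]
    simp
  have hmem : ∀ x, R x ∈ D := fun x => (hg.2.1 _).2 ⟨_, hder x⟩
  have hAR : ∀ x, A (R x) = μ • R x - x := fun x =>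
    tendsto_nhds_unique (hg.2.2 _ (hmem x)) (hder x)
  refine ⟨R, hmem, fun x => by rw [hAR]; abel, fun x hx => ?_, ?_, hform⟩
  · have h1 : R (A x) = A (R x) := by
      have h2 := ((R.continuous.tendsto _).comp (hg.2.2 x hx))
      refine tendsto_nhds_unique h2 ((hg.2.2 _ (hmem x)).congr' ?_)
      filter_upwards [self_mem_nhdsWithin] with r hr
      simp only [Function.comp, map_real_smul, map_sub]
      rw [hcomm2 x r (le_of_lt hr)]
    rw [map_sub, map_real_smul, h1, hAR]; abel
  · exact LinearMap.mkContinuous_norm_le _ (by positivity) _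

lemma gen_dense (hg : NBCS.IsGenerator A D T) {C : ℝ} (hC : ∀ h, 0 ≤ h → ‖T h‖ ≤ C) :
    Dense (D : Set X) := by
  obtain ⟨R, hm, -, -, -, hform⟩ := gen_resolvent hg hC one_pos
  intro x
  have hcont : ContinuousOn (fun r => Real.exp (-1 * r) • T r x) (Ici 0) :=
    ((show Continuous (fun r : ℝ => Real.exp (-1 * r)) by fun_prop).continuousOn).smul (hg.1.2.2 x)
  have h1 : HasDerivWithinAt (fun u => ∫ r in (0:ℝ)..u, Real.exp (-1 * r) • T r x)
      (Real.exp (-1 * 0) • T 0 x) (Ici 0) 0 := by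
    refine intervalIntegral.integral_hasDerivWithinAt_right (by simp) (t := Ioi 0) ?_ ?_
    · exact ⟨Ioi 0, self_mem_nhdsWithin,
        (hcont.mono Ioi_subset_Ici_self).aestronglyMeasurable measurableSet_Ioi⟩
    · exact (hcont 0 self_mem_Ici).mono Ioi_subset_Ici_self
  rw [rd_iff] at h1
  have hT0 : T 0 = 1 := hg.1.1
  simp only [mul_zero, Real.exp_zero, hT0, one_smul, ContinuousLinearMap.one_apply] at h1
  refine mem_closure_of_tendsto h1 ?_
  filter_upwards [self_mem_nhdsWithin] with h hh
  have hh' : (0:ℝ) ≤ h := le_of_lt hh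
  have h2 := hform x h hh'
  have h3 : ∫ r in (0:ℝ)..h, Real.exp (-1 * r) • T r x = R x - Real.exp (-h) • T h (R x) := by
    rw [h2, smul_smul, ← Real.exp_add]; simp
  have h4 : ∀ (r : ℝ) (y : X), y ∈ D → r • y ∈ D := fun r y hy => by
    rw [← Complex.coe_smul]; exact D.smul_mem _ hy
  simp only [zero_add, intervalIntegral.integral_same, sub_zero, SetLike.mem_coe]
  rw [h3]
  exact h4 _ _ (D.sub_mem (hm x) (h4 _ _ (gen_comm hg (hm x) hh').1))

end Gen
end KP

set_option linter.unusedSectionVars false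
set_option linter.deprecated false
set_option linter.unusedVariables false

namespace KP
open Topology

section Ev
variable {X : Type*} [NormedAddCommGroup X] [NormedSpace ℂ X] [CompleteSpace X]

/-- evolution families extended to the whole plane -/
structure Ev (E : ℝ → ℝ → X →L[ℂ] X) : Prop where
  one : ∀ t s, t ≤ s → E t s = 1
  comp : ∀ s r t, s ≤ r → r ≤ t → E t s = (E t r).comp (E r s)
  cont : ∀ x, Continuous (fun p : ℝ × ℝ => E p.1 p.2 x)

namespace Ev
variable {E : ℝ → ℝ → X →L[ℂ] X}

lemma comp_apply (hE : Ev E) {s r t : ℝ} (h1 : s ≤ r) (h2 : r ≤ t) (x : X) :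
    E t r (E r s x) = E t s x := by
  rw [hE.comp s r t h1 h2]; rfl

lemma cont_left (hE : Ev E) (s : ℝ) (x : X) : Continuous (fun t => E t s x) :=
  (hE.cont x).comp (by fun_prop : Continuous (fun t : ℝ => (t, s)))

lemma cont_right (hE : Ev E) (t : ℝ) (x : X) : Continuous (fun s => E t s x) :=
  (hE.cont x).comp (by fun_prop : Continuous (fun s : ℝ => (t, s)))

lemma bdd (hE : Ev E) (a b : ℝ) : ∃ C, 0 ≤ C ∧ ∀ t ∈ Icc a b, ∀ s ∈ Icc a b, ‖E t s‖ ≤ C := by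
  obtain ⟨C, h0, hC⟩ := bdd_of_compact (G := fun p : ℝ × ℝ => E p.1 p.2)
    ((isCompact_Icc (a := a) (b := b)).prod (isCompact_Icc (a := a) (b := b)))
    (fun x => (hE.cont x).continuousOn)
  exact ⟨C, h0, fun t ht s hs => hC (t, s) ⟨ht, hs⟩⟩

lemma rd_t (hE : Ev E) {s t : ℝ} (hst : s ≤ t) {x y' : X}
    (h : HasDerivWithinAt (fun r => E r t (E t s x)) y' (Ici t) t) :
    HasDerivWithinAt (fun r => E r s x) y' (Ici t) t :=
  h.congr (fun r hr => (hE.comp_apply hst hr x).symm) (hE.comp_apply hst le_rfl x).symm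

lemma rd_s (hE : Ev E) {r t : ℝ} (hrt : r < t) {u : ℝ → X} {u' b : X}
    (hu : HasDerivWithinAt u u' (Ici r) r)
    (hb : HasDerivWithinAt (fun ρ => E ρ r (u r)) b (Ici r) r) :
    HasDerivWithinAt (fun ρ => E t ρ (u ρ)) (E t r (u' - b)) (Ici r) r := by
  have h1 := hu.sub hb
  rw [rd_iff] at h1 ⊢
  have hsh : Tendsto (fun h : ℝ => r + h) (𝓝[>] 0) (𝓝 r) := by
    have : Tendsto (fun h : ℝ => r + h) (𝓝 0) (𝓝 (r + 0)) :=
      (continuous_const.add continuous_id).tendsto 0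
    rw [add_zero] at this
    exact this.mono_left nhdsWithin_le_nhds
  have h2 := tendsto_apply (G := fun h => E t (r + h)) (G0 := E t r)
    (fun x => ((hE.cont_right t x).tendsto r).comp hsh) h1
  refine h2.congr' ?_
  have hev : ∀ᶠ h in 𝓝[>] (0:ℝ), h < t - r :=
    nhdsWithin_le_nhds (gt_mem_nhds (by linarith))
  filter_upwards [hev, self_mem_nhdsWithin] with h hh hh0
  have hh0' : 0 < h := hh0
  rw [map_real_smul]
  congr 1
  simp only [Pi.sub_apply, map_sub]
  rw [hE.comp_apply (by linarith) (by linarith), hE.one r r le_rfl]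
  simp

lemma duhamel (hE : Ev E) {s t : ℝ} (hst : s ≤ t) {u u' b f : ℝ → X}
    (huc : ContinuousOn u (Icc s t)) (hf : ContinuousOn f (Icc s t))
    (hu : ∀ r ∈ Ioo s t, HasDerivWithinAt u (u' r) (Ici r) r)
    (hb : ∀ r ∈ Ioo s t, HasDerivWithinAt (fun ρ => E ρ r (u r)) (b r) (Ici r) r)
    (hfe : ∀ r ∈ Ioo s t, u' r - b r = f r) :
    u t = E t s (u s) + ∫ r in s..t, E t r (f r) := by
  have hc : ContinuousOn (fun r => E t r (u r)) (Icc s t) :=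
    continuousOn_apply (fun x => (hE.cont_right t x).continuousOn) huc
  have hc' : ContinuousOn (fun r => E t r (f r)) (Icc s t) :=
    continuousOn_apply (fun x => (hE.cont_right t x).continuousOn) hf
  have := intervalIntegral.integral_eq_sub_of_hasDeriv_right_of_le hst hc (f' := fun r => E t r (f r))
    (fun r hr => by
      rw [← hfe r hr]
      exact (hE.rd_s hr.2 (hu r hr) (hb r hr)).mono Ioi_subset_Ici_self)
    (hc'.intervalIntegrable_of_Icc hst)
  rw [this, hE.one t t le_rfl]
  simp

lemma duhamel_norm (hE : Ev E) {s t C : ℝ} (hst : s ≤ t) {u u' b : ℝ → X}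
    (huc : ContinuousOn u (Icc s t))
    (hu : ∀ r ∈ Ico s t, HasDerivWithinAt u (u' r) (Ici r) r)
    (hb : ∀ r ∈ Ico s t, HasDerivWithinAt (fun ρ => E ρ r (u r)) (b r) (Ici r) r)
    (hC : ∀ r ∈ Ico s t, ‖E t r (u' r - b r)‖ ≤ C) :
    ‖u t - E t s (u s)‖ ≤ C * (t - s) := by
  have hc : ContinuousOn (fun r => E t r (u r)) (Icc s t) :=
    continuousOn_apply (fun x => (hE.cont_right t x).continuousOn) huc
  have := norm_image_sub_le_of_norm_deriv_right_le_segment hc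
    (f' := fun r => E t r (u' r - b r))
    (fun r hr => hE.rd_s hr.2 (hu r hr) (hb r hr)) hC t (right_mem_Icc.2 hst)
  simpa [hE.one t t le_rfl] using this

end Ev
end Ev

section Cells
variable {X : Type*} [NormedAddCommGroup X] [NormedSpace ℂ X] [CompleteSpace X]

/-- length of the overlap of `[s,t]` with the `k`-th cell -/
def ell (δ : ℝ) (k : ℕ) (t s : ℝ) : ℝ := max 0 (min t ((k + 1) * δ) - max s (k * δ))

lemma ell_nonneg (δ : ℝ) (k : ℕ) (t s : ℝ) : 0 ≤ ell δ k t s := le_max_left _ _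

lemma ell_eq_zero {δ : ℝ} {k : ℕ} {t s : ℝ} (h : min t ((k + 1) * δ) ≤ max s (k * δ)) :
    ell δ k t s = 0 := max_eq_left (by linarith)

lemma ell_cont (δ : ℝ) (k : ℕ) : Continuous (fun p : ℝ × ℝ => ell δ k p.1 p.2) := by
  unfold ell; fun_prop

def prodU (T : ℝ → ℝ → X →L[ℂ] X) (δ : ℝ) : ℕ → ℝ → ℝ → X →L[ℂ] X
  | 0, _, _ => 1
  | k + 1, t, s => (T (k * δ) (ell δ k t s)).comp (prodU T δ k t s)

def apU (T : ℝ → ℝ → X →L[ℂ] X) (δ : ℝ) (t s : ℝ) : X →L[ℂ] X := prodU T δ (⌊t / δ⌋₊ + 1) t s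

variable {T : ℝ → ℝ → X →L[ℂ] X} {δ : ℝ}

lemma prodU_eq_one (hT : ∀ t, 0 ≤ t → NBCS.IsC0Semigroup (T t)) (hδ : 0 < δ) (k : ℕ) (t s : ℝ)
    (h : t ≤ s ∨ k * δ ≤ s) : prodU T δ k t s = 1 := by
  induction k with
  | zero => rfl
  | succ k ih =>
    have hk : (0:ℝ) ≤ k * δ := by positivity
    have h0 : ell δ k t s = 0 := by
      apply ell_eq_zero
      rcases h with h | h
      · exact (min_le_left _ _).trans (h.trans (le_max_left _ _))
      · push_cast at h
        exact (min_le_right _ _).trans (h.trans (le_max_left _ _))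
    have h1 : t ≤ s ∨ (k:ℝ) * δ ≤ s := by
      rcases h with h | h
      · exact Or.inl h
      · right; push_cast at h; linarith
    rw [prodU, h0, ih h1, (hT _ hk).1]; rfl

lemma prodU_stable (hT : ∀ t, 0 ≤ t → NBCS.IsC0Semigroup (T t)) (hδ : 0 < δ) (j : ℕ) (t s : ℝ)
    (h : t ≤ j * δ) (n : ℕ) : prodU T δ (j + n) t s = prodU T δ j t s := by
  induction n with
  | zero => rfl
  | succ n ih =>
    have hk : (0:ℝ) ≤ ((j + n : ℕ) : ℝ) * δ := by positivity
    have h0 : ell δ (j + n) t s = 0 := by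
      apply ell_eq_zero
      refine (min_le_left _ _).trans (le_trans ?_ (le_max_right _ _))
      refine h.trans ?_
      push_cast
      have : (0:ℝ) ≤ n * δ := by positivity
      linarith
    rw [← add_assoc, prodU, h0, ih, (hT _ hk).1]; rfl

lemma apU_eq (hT : ∀ t, 0 ≤ t → NBCS.IsC0Semigroup (T t)) (hδ : 0 < δ) (j : ℕ) (t s : ℝ)
    (h : t ≤ j * δ) : apU T δ t s = prodU T δ j t s := by
  have h2 : t ≤ ((⌊t / δ⌋₊ + 1 : ℕ) : ℝ) * δ := by
    have := (Nat.lt_floor_add_one (t / δ)).le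
    rw [div_le_iff₀ hδ] at this
    push_cast; exact this
  unfold apU
  rcases le_total j (⌊t / δ⌋₊ + 1) with hj | hj
  · obtain ⟨n, hn⟩ := Nat.exists_eq_add_of_le hj
    rw [hn, prodU_stable hT hδ j t s h n]
  · obtain ⟨n, hn⟩ := Nat.exists_eq_add_of_le hj
    rw [hn, prodU_stable hT hδ _ t s h2 n]

lemma prodU_comp (hT : ∀ t, 0 ≤ t → NBCS.IsC0Semigroup (T t)) (hδ : 0 < δ) (k : ℕ) {s r t : ℝ}
    (hsr : s ≤ r) (hrt : r ≤ t) :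
    prodU T δ k t s = (prodU T δ k t r).comp (prodU T δ k r s) := by
  induction k with
  | zero => rfl
  | succ k ih =>
    have hk : (0:ℝ) ≤ k * δ := by positivity
    have hell : ell δ k t s = ell δ k t r + ell δ k r s := by
      have h1 : (k:ℝ) * δ ≤ (k + 1) * δ := by linarith
      unfold ell
      generalize (k:ℝ) * δ = a at *
      generalize ((k:ℝ) + 1) * δ = b at *
      simp only [max_def, min_def]
      split_ifs <;> linarith
    by_cases h : r ≤ k * δ
    · have h0 : ell δ k r s = 0 :=
        ell_eq_zero ((min_le_left _ _).trans (h.trans (le_max_right _ _)))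
      simp only [prodU]
      rw [hell, h0, add_zero, (hT _ hk).1, ih]
      rfl
    · have h1 : prodU T δ k t r = 1 := prodU_eq_one hT hδ k t r (Or.inr (not_le.1 h).le)
      simp only [prodU]
      rw [hell, (hT _ hk).2.1 _ _ (ell_nonneg _ _ _ _) (ell_nonneg _ _ _ _), ih, h1]
      rfl

lemma prodU_cont (hT : ∀ t, 0 ≤ t → NBCS.IsC0Semigroup (T t)) (hδ : 0 < δ) (k : ℕ) (x : X) :
    Continuous (fun p : ℝ × ℝ => prodU T δ k p.1 p.2 x) := by
  induction k with
  | zero => exact continuous_const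
  | succ k ih =>
    have hk : (0:ℝ) ≤ k * δ := by positivity
    exact continuous_apply' (G := fun p : ℝ × ℝ => T (k * δ) (ell δ k p.1 p.2))
      (fun y => ((hT _ hk).2.2 y).comp_continuous (ell_cont δ k) (fun p => ell_nonneg _ _ _ _)) ih

lemma apU_ev (hT : ∀ t, 0 ≤ t → NBCS.IsC0Semigroup (T t)) (hδ : 0 < δ) : Ev (apU T δ) := by
  refine ⟨fun t s h => prodU_eq_one hT hδ _ t s (Or.inl h), fun s r t h1 h2 => ?_, fun x => ?_⟩
  · have h3 : t ≤ ((⌊t / δ⌋₊ + 1 : ℕ) : ℝ) * δ := by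
      have := (Nat.lt_floor_add_one (t / δ)).le
      rw [div_le_iff₀ hδ] at this
      push_cast; exact this
    rw [apU_eq hT hδ _ t s h3, apU_eq hT hδ _ t r h3, apU_eq hT hδ _ r s (h2.trans h3)]
    exact prodU_comp hT hδ _ h1 h2
  · rw [continuous_iff_continuousAt]
    intro p
    obtain ⟨j, hj⟩ := exists_nat_gt ((p.1) / δ)
    rw [div_lt_iff₀ hδ] at hj
    refine (prodU_cont hT hδ j x).continuousAt.congr ?_
    have : {q : ℝ × ℝ | q.1 < j * δ} ∈ 𝓝 p :=
      (isOpen_lt continuous_fst continuous_const).mem_nhds hj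
    filter_upwards [this] with q hq
    rw [apU_eq hT hδ j q.1 q.2 (le_of_lt hq)]

/-- the frozen time -/
def tau (δ t : ℝ) : ℝ := (⌊t / δ⌋₊ : ℝ) * δ

lemma tau_nonneg (hδ : 0 < δ) (t : ℝ) : 0 ≤ tau δ t := by unfold tau; positivity

lemma tau_le (hδ : 0 < δ) {t : ℝ} (ht : 0 ≤ t) : tau δ t ≤ t := by
  have := Nat.floor_le (div_nonneg ht hδ.le)
  rwa [le_div_iff₀ hδ] at this

lemma lt_tau (hδ : 0 < δ) (t : ℝ) : t < tau δ t + δ := by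
  have := Nat.lt_floor_add_one (t / δ)
  rw [div_lt_iff₀ hδ] at this
  unfold tau; linarith

lemma apU_diag (hT : ∀ t, 0 ≤ t → NBCS.IsC0Semigroup (T t)) (hδ : 0 < δ) {t r : ℝ} (ht : 0 ≤ t)
    (htr : t ≤ r) (hr : r ≤ tau δ t + δ) : apU T δ r t = T (tau δ t) (r - t) := by
  have h1 := tau_le hδ ht
  rw [apU_eq hT hδ (⌊t / δ⌋₊ + 1) r t (by unfold tau at hr; push_cast; linarith), prodU,
    prodU_eq_one hT hδ _ r t (Or.inr h1)]
  have : ell δ ⌊t / δ⌋₊ r t = r - t := by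
    unfold ell
    unfold tau at *
    rw [min_eq_left (by linarith), max_eq_left h1, max_eq_right (by linarith)]
  rw [this]; rfl

lemma apU_diag_rd {A : ℝ → X →ₗ[ℂ] X} {D : Submodule ℂ X}
    (hg : ∀ t, 0 ≤ t → NBCS.IsGenerator (A t) D (T t)) (hδ : 0 < δ) {t : ℝ} (ht : 0 ≤ t)
    {x : X} (hx : x ∈ D) :
    HasDerivWithinAt (fun r => apU T δ r t x) (A (tau δ t) x) (Ici t) t := by
  have hT : ∀ t, 0 ≤ t → NBCS.IsC0Semigroup (T t) := fun t ht => (hg t ht).1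
  have h := (hg _ (tau_nonneg hδ t)).2.2 x hx
  rw [rd_iff]
  refine h.congr' ?_
  have h2 := lt_tau hδ t
  have hev : ∀ᶠ h in 𝓝[>] (0:ℝ), h < tau δ t + δ - t :=
    nhdsWithin_le_nhds (gt_mem_nhds (by linarith))
  filter_upwards [hev, self_mem_nhdsWithin] with h hh hh0
  have hh0' : 0 < h := hh0
  rw [apU_diag hT hδ ht (by linarith) (by linarith), (apU_ev hT hδ).one t t le_rfl]
  simp

lemma prodU_mem {A : ℝ → X →ₗ[ℂ] X} {D : Submodule ℂ X}
    (hg : ∀ t, 0 ≤ t → NBCS.IsGenerator (A t) D (T t)) (hδ : 0 < δ) (k : ℕ) (t s : ℝ)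
    {x : X} (hx : x ∈ D) : prodU T δ k t s x ∈ D := by
  induction k with
  | zero => exact hx
  | succ k ih => exact (gen_comm (hg _ (by positivity)) ih (ell_nonneg _ _ _ _)).1

/-- abstract stability -/
lemma prodU_stab {M : ℝ → X → ℝ} {S : Set X} {T0 c : ℝ} (hT0 : 0 ≤ T0) (hc : 0 ≤ c)
    (hδ : 0 < δ) (hS : ∀ k t s x, x ∈ S → prodU T δ k t s x ∈ S)
    (hM0 : ∀ t ∈ Icc 0 T0, ∀ x ∈ S, 0 ≤ M t x)
    (hM1 : ∀ t ∈ Icc 0 T0, ∀ h, 0 ≤ h → ∀ x ∈ S, M t (T t h x) ≤ M t x)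
    (hM2 : ∀ t ∈ Icc 0 T0, ∀ s ∈ Icc 0 T0, ∀ x ∈ S, M t x ≤ (1 + c * |t - s|) * M s x)
    (t s : ℝ) {x : X} (hx : x ∈ S) (k : ℕ) (hk : k * δ ≤ T0) :
    M (k * δ) (prodU T δ (k + 1) t s x) ≤ Real.exp (c * (k * δ)) * M 0 x := by
  induction k with
  | zero =>
    have := hM1 0 ⟨le_rfl, hT0⟩ (ell δ 0 t s) (ell_nonneg _ _ _ _) x hx
    simpa [prodU] using this
  | succ k ih =>
    have hk1 : (k:ℝ) * δ ≤ T0 := by push_cast at hk; linarith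
    have hm1 : ((k+1 : ℕ) : ℝ) * δ ∈ Icc 0 T0 := ⟨by positivity, hk⟩
    have hm2 : ((k : ℕ) : ℝ) * δ ∈ Icc 0 T0 := ⟨by positivity, hk1⟩
    have hy := hS (k+1) t s x hx
    have h1 := hM1 _ hm1 (ell δ (k+1) t s) (ell_nonneg _ _ _ _) _ hy
    have h2 := hM2 _ hm1 _ hm2 _ hy
    have h3 : |((k+1 : ℕ) : ℝ) * δ - k * δ| = δ := by
      push_cast; rw [show ((k:ℝ) + 1) * δ - k * δ = δ by ring, abs_of_pos hδ]
    rw [h3] at h2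
    have h4 := ih hk1
    have h5 : 1 + c * δ ≤ Real.exp (c * δ) := by linarith [Real.add_one_le_exp (c * δ)]
    have h6 : Real.exp (c * (((k+1 : ℕ) : ℝ) * δ)) = Real.exp (c * δ) * Real.exp (c * (k * δ)) := by
      rw [← Real.exp_add]; congr 1; push_cast; ring
    rw [h6, mul_assoc]
    refine (h1.trans h2).trans ?_
    exact mul_le_mul h5 h4 (hM0 _ hm2 _ hy) (Real.exp_pos _).le

end Cells
end KP

set_option linter.unusedSectionVars false
set_option linter.deprecated false
set_option linter.unusedVariables false
namespace KP
open Topology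

section KS
variable {X : Type*} [NormedAddCommGroup X] [NormedSpace ℂ X] [CompleteSpace X]

/-- data extracted from the Kato class -/
structure KS (A : ℝ → X →ₗ[ℂ] X) (D : Submodule ℂ X) (T : ℝ → ℝ → X →L[ℂ] X) (N : ℝ → X → ℝ) :
    Prop where
  norm : ∀ t, 0 ≤ t → NBCS.IsEquivNorm (N t)
  lip : ∀ T : ℝ, 0 ≤ T → ∃ c : ℝ, 0 ≤ c ∧ ∀ (x : X), ∀ s ∈ Icc (0:ℝ) T, ∀ t ∈ Icc (0:ℝ) T,
      |N t x - N s x| ≤ c * |t - s| * N s x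
  gen : ∀ t, 0 ≤ t → NBCS.IsGenerator (A t) D (T t)
  contr : ∀ t, 0 ≤ t → ∀ h, 0 ≤ h → ∀ x, N t (T t h x) ≤ N t x
  smooth : ∀ x ∈ D, ContDiffOn ℝ 1 (fun t => A t x) (Ici (0:ℝ))

/-- the bounded-operator data used in the construction -/
structure KD (A : ℝ → X →ₗ[ℂ] X) (D : Submodule ℂ X) (T : ℝ → ℝ → X →L[ℂ] X)
    (K : X →L[ℂ] X) (a a' : ℝ → X →L[ℂ] X) : Prop where
  gen : ∀ t, 0 ≤ t → NBCS.IsGenerator (A t) D (T t)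
  mem : ∀ y, K y ∈ D
  surj : ∀ x ∈ D, ∃ y, K y = x
  inj : ∀ y, K y = 0 → y = 0
  aeq : ∀ t, 0 ≤ t → ∀ y, A t (K y) = a t y
  sc : ∀ T0, SC1 T0 a a'
  tb : ∀ T0, 0 ≤ T0 → ∃ C, 0 ≤ C ∧ ∀ t ∈ Icc 0 T0, ∀ h, 0 ≤ h → ‖T t h‖ ≤ C
  stab : ∀ T0, 0 ≤ T0 → ∃ C, 0 ≤ C ∧ ∀ δ, 0 < δ → ∀ t, t ≤ T0 → ∀ s,
    ‖apU T δ t s‖ ≤ C ∧ ∀ y, ∃ z, apU T δ t s (K y) = K z ∧ ‖z‖ ≤ C * ‖y‖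

variable {A : ℝ → X →ₗ[ℂ] X} {D : Submodule ℂ X} {T : ℝ → ℝ → X →L[ℂ] X} {N : ℝ → X → ℝ}

lemma KS.unif (h : KS A D T N) {T0 : ℝ} (hT0 : 0 ≤ T0) : ∃ m M : ℝ, 0 < m ∧ 0 < M ∧
    ∀ t ∈ Icc 0 T0, ∀ x, m * ‖x‖ ≤ N t x ∧ N t x ≤ M * ‖x‖ := by
  obtain ⟨-, -, -, m, M, hm, hM, hmM⟩ := h.norm 0 le_rfl
  obtain ⟨c, hc, hl⟩ := h.lip T0 hT0
  have hp : 0 < 1 + c * T0 := by positivity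
  have h00 : (0:ℝ) ∈ Icc 0 T0 := ⟨le_rfl, hT0⟩
  refine ⟨m / (1 + c * T0), (1 + c * T0) * M, by positivity, by positivity, fun t ht x => ?_⟩
  have h1 := (abs_le.1 (hl x 0 h00 t ht)).2
  have h2 := (abs_le.1 (hl x t ht 0 h00)).2
  have hN : 0 ≤ N t x := by
    obtain ⟨-, -, -, m', M', hm', hM', hmM'⟩ := h.norm t ht.1
    exact (by positivity : 0 ≤ m' * ‖x‖).trans (hmM' x).1
  have hN0 : 0 ≤ N 0 x := (by positivity : 0 ≤ m * ‖x‖).trans (hmM x).1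
  rw [sub_zero, abs_of_nonneg ht.1] at h1
  rw [zero_sub, abs_neg, abs_of_nonneg ht.1] at h2
  have h3 : c * t ≤ c * T0 := mul_le_mul_of_nonneg_left ht.2 hc
  have h4 := hmM x
  constructor
  · rw [div_mul_eq_mul_div, div_le_iff₀ hp]
    nlinarith
  · have : (1 + c * T0) * N 0 x ≤ (1 + c * T0) * (M * ‖x‖) := mul_le_mul_of_nonneg_left h4.2 hp.le
    nlinarith

lemma KS.tb (h : KS A D T N) {T0 : ℝ} (hT0 : 0 ≤ T0) : ∃ C, 0 ≤ C ∧ ∀ t ∈ Icc 0 T0,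
    ∀ h, 0 ≤ h → ‖T t h‖ ≤ C := by
  obtain ⟨m, M, hm, hM, hmM⟩ := h.unif hT0
  refine ⟨M / m, by positivity, fun t ht r hr => ContinuousLinearMap.opNorm_le_bound _ (by positivity) fun x => ?_⟩
  have h1 := (hmM t ht (T t r x)).1
  have h2 := h.contr t ht.1 r hr x
  have h3 := (hmM t ht x).2
  rw [div_mul_eq_mul_div, le_div_iff₀ hm]
  linarith

lemma bij_unit {L : X →L[ℂ] X} (hi : ∀ y, L y = 0 → y = 0) (hs : ∀ x, ∃ y, L y = x) : IsUnit L := by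
  rw [ContinuousLinearMap.isUnit_iff_bijective]
  exact ⟨(injective_iff_map_eq_zero L).2 hi, hs⟩

lemma inv_left {L : X →L[ℂ] X} (h : IsUnit L) (x : X) : Ring.inverse L (L x) = x := by
  have := Ring.inverse_mul_cancel L h
  exact congrArg (fun F : X →L[ℂ] X => F x) this

lemma inv_right {L : X →L[ℂ] X} (h : IsUnit L) (x : X) : L (Ring.inverse L x) = x := by
  have := Ring.mul_inverse_cancel L h
  exact congrArg (fun F : X →L[ℂ] X => F x) this

lemma KS.exists_KD (h : KS A D T N) : ∃ K a a', KD A D T K a a' := by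
  obtain ⟨C0, hC0, hC⟩ := h.tb (T0 := 0) le_rfl
  obtain ⟨K, hK1, hK2, hK3, -, -⟩ := gen_resolvent (h.gen 0 le_rfl) (hC 0 ⟨le_rfl, le_rfl⟩) one_pos
  simp only [one_smul] at hK2 hK3
  have hsurj : ∀ x ∈ D, ∃ y, K y = x := fun x hx => ⟨_, hK3 x hx⟩
  have hinj : ∀ y, K y = 0 → y = 0 := fun y hy => by
    have := hK2 y
    rw [hy] at this; simpa using this.symm
  have hres : ∀ t, 0 ≤ t → ∃ R : X →L[ℂ] X, (∀ x, R x ∈ D) ∧ (∀ x, R x - A t (R x) = x) ∧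
      (∀ x ∈ D, R (x - A t x) = x) := by
    intro t ht
    obtain ⟨C1, hC1, hC1'⟩ := h.tb (T0 := t) ht
    obtain ⟨R, hR1, hR2, hR3, -, -⟩ := gen_resolvent (h.gen t ht) (hC1' t ⟨ht, le_rfl⟩) one_pos
    simp only [one_smul] at hR2 hR3
    exact ⟨R, hR1, hR2, hR3⟩
  have hbd : ∀ t, 0 ≤ t → ∃ B : X →L[ℂ] X, ∀ y, B y = A t (K y) := by
    intro t ht
    obtain ⟨R, hR1, hR2, hR3⟩ := hres t ht
    have hc : Continuous (A t ∘ₗ (K : X →ₗ[ℂ] X)) := by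
      apply LinearMap.continuous_of_seq_closed_graph
      intro u x y hu hv
      have h1 : Tendsto (fun n => R (K (u n) - A t (K (u n)))) atTop (𝓝 (R (K x - y))) :=
        (R.continuous.tendsto _).comp (((K.continuous.tendsto _).comp hu).sub hv)
      have h2 : Tendsto (fun n => R (K (u n) - A t (K (u n)))) atTop (𝓝 (K x)) := by
        refine ((K.continuous.tendsto _).comp hu).congr (fun n => ?_)
        rw [hR3 _ (hK1 _)]; rfl
      have h3 := tendsto_nhds_unique h1 h2
      have h4 := hR2 (K x - y)
      rw [h3] at h4
      have : A t (K x) = y := by simpa using h4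
      simp [this]
    exact ⟨⟨_, hc⟩, fun y => rfl⟩
  choose! a ha using hbd
  obtain ⟨a', ha', -⟩ := sc1_of_contDiffOn (G := a) (fun y =>
    (h.smooth (K y) (hK1 y)).congr (fun t ht => ha t ht y))
  refine ⟨K, a, a', h.gen, hK1, hsurj, hinj, fun t ht y => (ha t ht y).symm, ha', fun T0 hT0 => h.tb hT0,
    fun T0 hT0 => ?_⟩
  obtain ⟨m, M, hm, hM, hmM⟩ := h.unif hT0
  obtain ⟨c, hc, hl⟩ := h.lip T0 hT0
  have hu : ∀ t ∈ Icc 0 T0, IsUnit (K - a t) := by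
    intro t ht
    obtain ⟨R, hR1, hR2, hR3⟩ := hres t ht.1
    apply bij_unit
    · intro y hy
      have h1 := hR3 (K y) (hK1 y)
      rw [← ha t ht.1 y, ← ContinuousLinearMap.sub_apply, hy, map_zero] at h1
      exact hinj y h1.symm
    · intro x
      obtain ⟨y, hy⟩ := hsurj _ (hR1 x)
      refine ⟨y, ?_⟩
      rw [ContinuousLinearMap.sub_apply, ha t ht.1, hy, hR2]
  have hL : SC1 T0 (fun t => K - a t) (fun t => 0 - a' t) := (SC1.const T0 K).sub (ha' T0)
  obtain ⟨Ci, hCi0, hCi⟩ := bdd_of_compact isCompact_Icc (hL.inv hu).cont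
  obtain ⟨Cl, hCl0, hCl⟩ := hL.lip
  have hLi : ∀ t ∈ Icc 0 T0, ∀ y, ‖y‖ ≤ Ci / m * N t ((K - a t) y) := by
    intro t ht y
    have h1 : ‖y‖ ≤ Ci * ‖(K - a t) y‖ := by
      have := (Ring.inverse (K - a t)).le_of_opNorm_le (hCi t ht) ((K - a t) y)
      rwa [inv_left (hu t ht)] at this
    have h2 := (hmM t ht ((K - a t) y)).1
    refine h1.trans ?_
    rw [div_mul_eq_mul_div, le_div_iff₀ hm]
    nlinarith
  have hN0 : ∀ t ∈ Icc 0 T0, ∀ x, 0 ≤ N t x := fun t ht x =>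
    (by positivity : 0 ≤ m * ‖x‖).trans (hmM t ht x).1
  have hNl : ∀ t ∈ Icc 0 T0, ∀ s ∈ Icc 0 T0, ∀ x, N t x ≤ (1 + c * |t - s|) * N s x := by
    intro t ht s hs x
    have := (abs_le.1 (hl x s hs t ht)).2
    linarith
  set c' := c + M * Cl * (Ci / m) with hc'
  have hc'0 : 0 ≤ c' := by positivity
  have h00 : (0:ℝ) ∈ Icc 0 T0 := ⟨le_rfl, hT0⟩
  have hk : ∀ δ, 0 < δ → ∀ t, t ≤ T0 → (⌊t / δ⌋₊ : ℝ) * δ ∈ Icc 0 T0 := by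
    intro δ hδ t ht
    refine ⟨by positivity, ?_⟩
    rcases le_total 0 t with h0 | h0
    · exact (tau_le hδ h0).trans ht
    · rw [Nat.floor_of_nonpos (div_nonpos_of_nonpos_of_nonneg h0 hδ.le)]; simpa
  set e := Real.exp (c' * T0)
  refine ⟨e * (M / m) + Ci / m * (e * (M * ‖K - a 0‖)), by positivity, fun δ hδ t ht s => ⟨?_, fun y => ?_⟩⟩
  · refine ContinuousLinearMap.opNorm_le_bound _ (by positivity) fun x => ?_
    have h1 := prodU_stab (M := N) (S := univ) hT0 hc'0 hδ (fun _ _ _ _ _ => mem_univ _)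
      (fun t ht x _ => hN0 t ht x) (fun t ht h' hh x _ => h.contr t ht.1 h' hh x)
      (fun t ht s hs x _ => (hNl t ht s hs x).trans (by
        have : c ≤ c' := by rw [hc']; linarith [show 0 ≤ M * Cl * (Ci / m) by positivity]
        have := hN0 s hs x
        gcongr)) t s (mem_univ x) ⌊t / δ⌋₊ (hk δ hδ t ht).2
    have h2 := (hmM _ (hk δ hδ t ht) (apU T δ t s x)).1
    have h3 := (hmM _ h00 x).2
    have h4 : Real.exp (c' * ((⌊t / δ⌋₊ : ℝ) * δ)) ≤ e := by
      apply Real.exp_le_exp.2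
      exact mul_le_mul_of_nonneg_left (hk δ hδ t ht).2 hc'0
    have h5 : m * ‖apU T δ t s x‖ ≤ e * (M * ‖x‖) :=
      h2.trans (h1.trans (mul_le_mul h4 h3 (hN0 _ h00 x) (by positivity)))
    have h6 : ‖apU T δ t s x‖ ≤ e * (M / m) * ‖x‖ := by
      rw [show e * (M / m) * ‖x‖ = e * (M * ‖x‖) / m by ring, le_div_iff₀ hm]
      linarith
    refine h6.trans ?_
    have : 0 ≤ Ci / m * (e * (M * ‖K - a 0‖)) := by positivity
    gcongr
    linarith
  · have hDm : apU T δ t s (K y) ∈ D := prodU_mem h.gen hδ _ _ _ (hK1 y)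
    obtain ⟨z, hz⟩ := hsurj _ hDm
    refine ⟨z, hz.symm, ?_⟩
    have hKa : ∀ t ∈ Icc 0 T0, ∀ y, K y - A t (K y) = (K - a t) y := fun t ht y => by
      rw [ContinuousLinearMap.sub_apply, ha t ht.1]
    have h1 := prodU_stab (T := T) (M := fun t x => N t (x - A t x)) (S := (D : Set X)) hT0 hc'0 hδ
      (fun k t s x hx => prodU_mem h.gen hδ k t s hx)
      (fun t ht x _ => hN0 t ht _)
      (fun t ht h' hh x hx => by
        obtain ⟨-, e2⟩ := gen_comm (h.gen t ht.1) hx hh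
        simp only [e2, ← map_sub]
        exact h.contr t ht.1 h' hh _)
      (fun t ht s hs x hx => by
        obtain ⟨y, rfl⟩ := hsurj x hx
        simp only [hKa t ht, hKa s hs]
        have e1 : (K - a t) y = (K - a s) y + ((K - a t) - (K - a s)) y := by simp
        have e2 := (h.norm t ht.1).1 ((K - a s) y) (((K - a t) - (K - a s)) y)
        rw [← e1] at e2
        have e3 := hNl t ht s hs ((K - a s) y)
        have e4 := (hmM t ht (((K - a t) - (K - a s)) y)).2
        have e5 := (((K - a t) - (K - a s))).le_of_opNorm_le (hCl s hs t ht) y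
        have e6 := hLi s hs y
        have e7 : M * ‖((K - a t) - (K - a s)) y‖ ≤ M * (Cl * |t - s| * (Ci / m * N s ((K - a s) y))) := by
          refine mul_le_mul_of_nonneg_left (e5.trans ?_) hM.le
          exact mul_le_mul_of_nonneg_left e6 (by positivity)
        rw [hc']
        calc _ ≤ _ := e2
          _ ≤ (1 + c * |t - s|) * N s ((K - a s) y) + M * (Cl * |t - s| * (Ci / m * N s ((K - a s) y))) :=
            add_le_add e3 (e4.trans e7)
          _ = _ := by ring) t s (hK1 y) ⌊t / δ⌋₊ (hk δ hδ t ht).2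
    have h1' : N ((⌊t / δ⌋₊ : ℝ) * δ) (apU T δ t s (K y) - A ((⌊t / δ⌋₊ : ℝ) * δ) (apU T δ t s (K y)))
      ≤ Real.exp (c' * ((⌊t / δ⌋₊ : ℝ) * δ)) * N 0 (K y - A 0 (K y)) := h1
    rw [← hz, hKa _ (hk δ hδ t ht), hKa _ h00] at h1'
    have h2 := hLi _ (hk δ hδ t ht) z
    have h4 : Real.exp (c' * ((⌊t / δ⌋₊ : ℝ) * δ)) ≤ e := by
      apply Real.exp_le_exp.2
      exact mul_le_mul_of_nonneg_left (hk δ hδ t ht).2 hc'0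
    have h3 : N 0 ((K - a 0) y) ≤ M * ‖K - a 0‖ * ‖y‖ := by
      refine (hmM 0 h00 _).2.trans ?_
      rw [mul_assoc]
      exact mul_le_mul_of_nonneg_left ((K - a 0).le_opNorm y) hM.le
    have h5 : ‖z‖ ≤ Ci / m * (e * (M * ‖K - a 0‖ * ‖y‖)) := by
      refine h2.trans (mul_le_mul_of_nonneg_left (h1'.trans ?_) (by positivity))
      exact mul_le_mul h4 h3 (hN0 _ h00 _) (by positivity)
    have : 0 ≤ e * (M / m) * ‖y‖ := by positivity
    nlinarith

lemma KD.unitμ {K : X →L[ℂ] X} {a a' : ℝ → X →L[ℂ] X} (h : KD A D T K a a') {T0 : ℝ} (hT0 : 0 ≤ T0)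
    {P : ℝ → X →L[ℂ] X} {Cp : ℝ} (hCp : 0 ≤ Cp) (hP : ∀ t ∈ Icc 0 T0, ‖P t‖ ≤ Cp) :
    ∃ μ : ℝ, 0 < μ ∧ ∀ t ∈ Icc 0 T0, IsUnit (μ • K - a t - (P t).comp K) := by
  obtain ⟨C, hC0, hC⟩ := h.tb T0 hT0
  refine ⟨Cp * C + 1, by positivity, fun t ht => ?_⟩
  set μ := Cp * C + 1
  have hμ : 0 < μ := by positivity
  obtain ⟨R, hR1, hR2, hR3, hR4, -⟩ := gen_resolvent (h.gen t ht.1) (hC t ht) hμ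
  have hS : IsUnit (μ • K - a t) := by
    apply bij_unit
    · intro y hy
      have h1 := hR3 (K y) (h.mem y)
      have : μ • K y - A t (K y) = 0 := by
        rw [h.aeq t ht.1]; simpa using hy
      rw [this, map_zero] at h1
      exact h.inj y h1.symm
    · intro x
      obtain ⟨y, hy⟩ := h.surj _ (hR1 x)
      refine ⟨y, ?_⟩
      have := hR2 x
      rw [← hy, h.aeq t ht.1] at this
      simpa using this
  have hPR : ‖P t * R‖ < 1 := by
    refine (norm_mul_le _ _).trans_lt ?_
    have : ‖P t‖ * ‖R‖ ≤ Cp * (C / μ) := mul_le_mul (hP t ht) hR4 (norm_nonneg _) hCp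
    refine this.trans_lt ?_
    rw [← mul_div_assoc, div_lt_one hμ]
    simp [μ]
  have h1 := (isUnit_one_sub_of_norm_lt_one hPR).mul hS
  convert h1 using 1
  ext y
  have h2 := hR3 (K y) (h.mem y)
  rw [h.aeq t ht.1] at h2
  have h3 : R ((μ • K - a t) y) = K y := h2
  have : ((1 - P t * R) * (μ • K - a t)) y = (μ • K - a t) y - P t (R ((μ • K - a t) y)) := rfl
  rw [this, h3]; rfl

end KS
end KP

set_option linter.unusedSectionVars false
set_option linter.deprecated false
set_option linter.unusedVariables false
namespace KP
open Topology

section KU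
variable {X : Type*} [NormedAddCommGroup X] [NormedSpace ℂ X] [CompleteSpace X]

lemma exists_strong_limit {B : ℕ → X →L[ℂ] X} {C : ℝ} (hC : 0 ≤ C) (hB : ∀ n, ‖B n‖ ≤ C) {S : Set X}
    (hS : Dense S) (h : ∀ x ∈ S, CauchySeq (fun n => B n x)) :
    ∃ B0 : X →L[ℂ] X, (∀ x, Tendsto (fun n => B n x) atTop (𝓝 (B0 x))) ∧ ‖B0‖ ≤ C := by
  have hcau : ∀ x, CauchySeq (fun n => B n x) := by
    intro x
    rw [Metric.cauchySeq_iff']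
    intro ε hε
    obtain ⟨y, hyS, hy⟩ := hS.exists_dist_lt x (show 0 < ε / (3 * (C + 1)) by positivity)
    obtain ⟨n0, hn0⟩ := Metric.cauchySeq_iff'.1 (h y hyS) (ε / 3) (by positivity)
    refine ⟨n0, fun n hn => ?_⟩
    have h1 := hn0 n hn
    rw [dist_eq_norm] at *
    have e : B n x - B n0 x = B n (x - y) - B n0 (x - y) + (B n y - B n0 y) := by
      simp only [map_sub]; abel
    have h2 : ‖B n (x - y)‖ ≤ C * ‖x - y‖ := (B n).le_of_opNorm_le (hB n) _
    have h3 : ‖B n0 (x - y)‖ ≤ C * ‖x - y‖ := (B n0).le_of_opNorm_le (hB n0) _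
    have h4 : C * ‖x - y‖ ≤ ε / 3 := by
      rw [lt_div_iff₀ (by positivity)] at hy
      nlinarith [norm_nonneg (x - y)]
    rw [e]
    have h5 := norm_add_le (B n (x - y) - B n0 (x - y)) (B n y - B n0 y)
    have h6 := norm_sub_le (B n (x - y)) (B n0 (x - y))
    linarith
  have hlim : ∀ x, ∃ l, Tendsto (fun n => B n x) atTop (𝓝 l) := fun x => cauchySeq_tendsto_of_complete (hcau x)
  choose f hf using hlim
  refine ⟨continuousLinearMapOfTendsto (σ₁₂ := RingHom.id ℂ) B (f := f) (tendsto_pi_nhds.2 hf), fun x => hf x, ?_⟩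
  refine ContinuousLinearMap.opNorm_le_bound _ hC fun x => ?_
  exact le_of_tendsto (hf x).norm (Eventually.of_forall fun n => (B n).le_of_opNorm_le (hB n) x)

variable {A : ℝ → X →ₗ[ℂ] X} {D : Submodule ℂ X} {T : ℝ → ℝ → X →L[ℂ] X}
variable {K : X →L[ℂ] X} {a a' : ℝ → X →L[ℂ] X}

lemma KD.sg (h : KD A D T K a a') : ∀ t, 0 ≤ t → NBCS.IsC0Semigroup (T t) := fun t ht => (h.gen t ht).1

lemma KD.dense (h : KD A D T K a a') : Dense (D : Set X) := by
  obtain ⟨C, hC0, hC⟩ := h.tb 0 le_rfl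
  exact gen_dense (h.gen 0 le_rfl) (hC 0 ⟨le_rfl, le_rfl⟩)

lemma KD.key (h : KD A D T K a a') {T0 : ℝ} (hT0 : 0 ≤ T0) : ∃ C, 0 ≤ C ∧ ∀ δ, 0 < δ → ∀ B ε, 0 ≤ B → 0 ≤ ε →
    ∀ s t, 0 ≤ s → s ≤ t → t ≤ T0 → ∀ u y : ℝ → X, ∀ σ : ℝ → ℝ, ContinuousOn u (Icc s t) →
    (∀ r ∈ Ico s t, u r = K (y r) ∧ ‖y r‖ ≤ B ∧ σ r ∈ Icc 0 T0 ∧ |σ r - r| ≤ ε ∧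
      HasDerivWithinAt u (A (σ r) (u r)) (Ici r) r) →
    ‖u t - apU T δ t s (u s)‖ ≤ C * B * (ε + δ) * (t - s) := by
  obtain ⟨C1, hC10, hC1⟩ := h.stab T0 hT0
  obtain ⟨Cl, hCl0, hCl⟩ := (h.sc T0).lip
  refine ⟨C1 * Cl, by positivity, fun δ hδ B ε hB hε s t hs hst ht u y σ huc hu => ?_⟩
  refine (apU_ev h.sg hδ).duhamel_norm hst huc (fun r hr => (hu r hr).2.2.2.2)
    (fun r hr => apU_diag_rd h.gen hδ (hs.trans hr.1) (x := u r) ((hu r hr).1 ▸ h.mem _)) fun r hr => ?_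
  obtain ⟨e1, e2, e3, e4, -⟩ := hu r hr
  have hr0 : 0 ≤ r := hs.trans hr.1
  have t1 := tau_nonneg hδ r
  have t2 := tau_le hδ hr0
  have t3 := lt_tau hδ r
  have t4 : tau δ r ∈ Icc 0 T0 := ⟨t1, t2.trans (hr.2.le.trans ht)⟩
  rw [e1, h.aeq _ e3.1, h.aeq _ t1, ← ContinuousLinearMap.sub_apply]
  have h1 := (a (σ r) - a (tau δ r)).le_of_opNorm_le (hCl _ t4 _ e3) (y r)
  have h2 := (apU T δ t r).le_of_opNorm_le ((hC1 δ hδ t ht r).1) ((a (σ r) - a (tau δ r)) (y r))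
  have h3 : |σ r - tau δ r| ≤ ε + δ := by
    have := abs_sub_le (σ r) r (tau δ r)
    rw [abs_of_nonneg (show 0 ≤ r - tau δ r by linarith)] at this
    linarith
  calc _ ≤ _ := h2
    _ ≤ C1 * (Cl * (ε + δ) * B) := by
      refine mul_le_mul_of_nonneg_left (h1.trans ?_) hC10
      gcongr
    _ = _ := by ring

lemma apU_mem (h : KD A D T K a a') {δ : ℝ} (hδ : 0 < δ) (t s : ℝ) {x : X} (hx : x ∈ D) :
    apU T δ t s x ∈ D := prodU_mem h.gen hδ _ _ _ hx

lemma apU_rd (h : KD A D T K a a') {δ : ℝ} (hδ : 0 < δ) {s r : ℝ} (hs : 0 ≤ s) (hr : s ≤ r) {x : X} (hx : x ∈ D) :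
    HasDerivWithinAt (fun r => apU T δ r s x) (A (tau δ r) (apU T δ r s x)) (Ici r) r :=
  (apU_ev h.sg hδ).rd_t hr (apU_diag_rd h.gen hδ (hs.trans hr) (apU_mem h hδ r s hx))

lemma KD.cau (h : KD A D T K a a') {T0 : ℝ} (hT0 : 0 ≤ T0) : ∃ C, 0 ≤ C ∧ ∀ δ, 0 < δ → ∀ δ', 0 < δ' →
    ∀ s t, 0 ≤ s → s ≤ t → t ≤ T0 → ∀ y,
    ‖apU T δ' t s (K y) - apU T δ t s (K y)‖ ≤ C * ‖y‖ * (δ' + δ) * (t - s) := by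
  obtain ⟨C1, hC10, hC1⟩ := h.stab T0 hT0
  obtain ⟨C, hC0, hC⟩ := h.key hT0
  refine ⟨C * C1, by positivity, fun δ hδ δ' hδ' s t hs hst ht y => ?_⟩
  have hz : ∀ r, ∃ z, r ≤ T0 → apU T δ' r s (K y) = K z ∧ ‖z‖ ≤ C1 * ‖y‖ := by
    intro r
    by_cases hr : r ≤ T0
    · obtain ⟨z, hz⟩ := (hC1 δ' hδ' r hr s).2 y
      exact ⟨z, fun _ => hz⟩
    · exact ⟨0, fun h => absurd h hr⟩
  choose z hz using hz
  have := hC δ hδ (C1 * ‖y‖) δ' (by positivity) hδ'.le s t hs hst ht (fun r => apU T δ' r s (K y)) z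
    (tau δ') ((apU_ev h.sg hδ').cont_left s _).continuousOn (fun r hr => by
      have hr0 : 0 ≤ r := hs.trans hr.1
      have t1 := tau_nonneg hδ' r
      have t2 := tau_le hδ' hr0
      have t3 := lt_tau hδ' r
      have hrT : r ≤ T0 := hr.2.le.trans ht
      refine ⟨(hz r hrT).1, (hz r hrT).2, ⟨t1, t2.trans hrT⟩, ?_, apU_rd h hδ' hs hr.1 (h.mem y)⟩
      rw [abs_sub_comm, abs_of_nonneg (by linarith)]; linarith)
  simp only [(apU_ev h.sg hδ').one s s le_rfl, ContinuousLinearMap.one_apply] at this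
  refine this.trans (le_of_eq (by ring))

lemma Ev.trunc {E : ℝ → ℝ → X →L[ℂ] X} (hE : Ev E) : Ev (fun t s => E t (max s 0)) := by
  refine ⟨fun t s hts => hE.one _ _ (hts.trans (le_max_left _ _)), fun s r t hsr hrt => ?_, fun x => ?_⟩
  · rcases le_total 0 r with h0 | h0
    · skip
      rw [max_eq_left h0]
      rcases le_total s 0 with h1 | h1
      · rw [max_eq_right h1]; exact hE.comp _ _ _ h0 hrt
      · rw [max_eq_left h1]; exact hE.comp _ _ _ hsr hrt
    · skip
      rw [max_eq_right h0, max_eq_right (hsr.trans h0), hE.one r 0 h0]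
      rfl
  · exact (hE.cont x).comp (by fun_prop : Continuous (fun p : ℝ × ℝ => (p.1, max p.2 0)))

/-- the evolution family of the unperturbed problem -/
structure KU (A : ℝ → X →ₗ[ℂ] X) (D : Submodule ℂ X) (T : ℝ → ℝ → X →L[ℂ] X)
    (K : X →L[ℂ] X) (U : ℝ → ℝ → X →L[ℂ] X) : Prop where
  ev : Ev U
  conv : ∀ T0, 0 ≤ T0 → ∃ C, 0 ≤ C ∧ ∀ δ, 0 < δ → ∀ s t, 0 ≤ s → s ≤ t → t ≤ T0 → ∀ y,
    ‖apU T δ t s (K y) - U t s (K y)‖ ≤ C * ‖y‖ * δ * (t - s)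

lemma KD.exists_U (h : KD A D T K a a') : ∃ U, KU A D T K U := by
  set d : ℕ → ℝ := fun n => 1 / ((n:ℝ) + 1) with hd
  have hd0 : ∀ n, 0 < d n := fun n => by simp only [hd]; positivity
  have hdt : Tendsto d atTop (𝓝 0) := tendsto_one_div_add_atTop_nhds_zero_nat
  have hda : ∀ n m, n ≤ m → d m ≤ d n := fun n m hnm => by
    simp only [hd]; gcongr
  have hE : ∀ n, Ev (fun t s => apU T (d n) t (max s 0)) := fun n => (apU_ev h.sg (hd0 n)).trunc
  -- estimate for all `t ≤ T0` and all `s`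
  have hest : ∀ T0, 0 ≤ T0 → ∃ C, 0 ≤ C ∧ ∀ n m t s, t ≤ T0 → ∀ y,
      ‖apU T (d m) t (max s 0) (K y) - apU T (d n) t (max s 0) (K y)‖ ≤ C * ‖y‖ * (d m + d n) := by
    intro T0 hT0
    obtain ⟨C, hC0, hC⟩ := h.cau hT0
    refine ⟨C * T0, by positivity, fun n m t s ht y => ?_⟩
    rcases le_total t (max s 0) with h1 | h1
    · rw [(apU_ev h.sg (hd0 n)).one _ _ h1, (apU_ev h.sg (hd0 m)).one _ _ h1]
      have := hd0 n
      have := hd0 m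
      simp only [sub_self, norm_zero]; positivity
    · refine (hC _ (hd0 n) _ (hd0 m) (max s 0) t (le_max_right _ _) h1 ht y).trans ?_
      have := hd0 n
      have := hd0 m
      have h2 : t - max s 0 ≤ T0 := by linarith [le_max_right s 0]
      calc _ ≤ C * ‖y‖ * (d m + d n) * T0 := by gcongr
        _ = _ := by ring
  have hlim : ∀ t s, ∃ B : X →L[ℂ] X, (∀ x, Tendsto (fun n => apU T (d n) t (max s 0) x) atTop (𝓝 (B x))) ∧
      ∀ C, 0 ≤ C → (∀ n, ‖apU T (d n) t (max s 0)‖ ≤ C) → ‖B‖ ≤ C := by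
    intro t s
    obtain ⟨C1, hC10, hC1⟩ := h.stab (max t 0) (le_max_right _ _)
    obtain ⟨C, hC0, hC⟩ := hest (max t 0) (le_max_right _ _)
    obtain ⟨B, hB, -⟩ := exists_strong_limit (B := fun n => apU T (d n) t (max s 0)) hC10
      (fun n => (hC1 _ (hd0 n) t (le_max_left _ _) _).1) h.dense (fun x hx => by
        obtain ⟨y, rfl⟩ := h.surj x hx
        refine cauchySeq_of_le_tendsto_0 (fun n => C * ‖y‖ * (d n + d n)) (fun n m N hn hm => ?_) ?_
        · rw [dist_eq_norm]
          refine (hC m n t s (le_max_left _ _) y).trans ?_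
          have := hda _ _ hn
          have := hda _ _ hm
          gcongr
        · simpa using (hdt.add hdt).const_mul (C * ‖y‖))
    refine ⟨B, hB, fun C hC0 hC => ContinuousLinearMap.opNorm_le_bound _ hC0 fun x => ?_⟩
    exact le_of_tendsto (hB x).norm (Eventually.of_forall fun n => (apU T (d n) t (max s 0)).le_of_opNorm_le (hC n) x)
  choose U hU hUb using hlim
  have hlin : ∀ T0, 0 ≤ T0 → ∃ C, 0 ≤ C ∧ ∀ n t s, t ≤ T0 → ∀ y,
      ‖apU T (d n) t (max s 0) (K y) - U t s (K y)‖ ≤ C * ‖y‖ * d n := by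
    intro T0 hT0
    obtain ⟨C, hC0, hC⟩ := hest T0 hT0
    refine ⟨C, hC0, fun n t s ht y => ?_⟩
    have h1 := (tendsto_const_nhds (x := apU T (d n) t (max s 0) (K y))).sub (hU t s (K y))
    have h2 : Tendsto (fun m => C * ‖y‖ * (d n + d m)) atTop (𝓝 (C * ‖y‖ * (d n + 0))) :=
      (hdt.const_add (d n)).const_mul _
    rw [add_zero] at h2
    exact le_of_tendsto_of_tendsto h1.norm h2 (Eventually.of_forall fun m => hC m n t s ht y)
  have hunif : ∀ T0, 0 ≤ T0 → ∀ x, TendstoUniformlyOn (fun n (p : ℝ × ℝ) => apU T (d n) p.1 (max p.2 0) x)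
      (fun p => U p.1 p.2 x) atTop {p | p.1 < T0} := by
    intro T0 hT0 x
    obtain ⟨C, hC0, hC⟩ := hlin T0 hT0
    obtain ⟨C1, hC10, hC1⟩ := h.stab T0 hT0
    rw [Metric.tendstoUniformlyOn_iff]
    intro ε hε
    obtain ⟨x', hx', hxx⟩ := h.dense.exists_dist_lt x (show 0 < ε / (4 * (C1 + 1)) by positivity)
    obtain ⟨y, rfl⟩ := h.surj x' hx'
    have h1 : Tendsto (fun n => C * ‖y‖ * d n) atTop (𝓝 0) := by simpa using hdt.const_mul (C * ‖y‖)
    filter_upwards [h1.eventually (gt_mem_nhds (show 0 < ε / 2 by positivity))] with n hn p hp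
    have hp' : p.1 ≤ T0 := le_of_lt hp
    have h2 := hC n p.1 p.2 hp' y
    have h3 := (U p.1 p.2).le_of_opNorm_le (hUb p.1 p.2 C1 hC10 fun n => (hC1 _ (hd0 n) _ hp' _).1) (x - K y)
    have h4 := (apU T (d n) p.1 (max p.2 0)).le_of_opNorm_le (hC1 _ (hd0 n) _ hp' _).1 (x - K y)
    rw [dist_eq_norm] at hxx ⊢
    have h5 : C1 * ‖x - K y‖ ≤ ε / 4 := by
      rw [lt_div_iff₀ (by positivity)] at hxx
      nlinarith [norm_nonneg (x - K y)]
    have e : U p.1 p.2 x - apU T (d n) p.1 (max p.2 0) x = U p.1 p.2 (x - K y) -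
      apU T (d n) p.1 (max p.2 0) (x - K y) - (apU T (d n) p.1 (max p.2 0) (K y) - U p.1 p.2 (K y)) := by
      simp only [map_sub]; abel
    rw [e]
    have h6 := norm_sub_le (U p.1 p.2 (x - K y) - apU T (d n) p.1 (max p.2 0) (x - K y))
      (apU T (d n) p.1 (max p.2 0) (K y) - U p.1 p.2 (K y))
    have h7 := norm_sub_le (U p.1 p.2 (x - K y)) (apU T (d n) p.1 (max p.2 0) (x - K y))
    linarith
  have hev : Ev U := by
    refine ⟨fun t s hts => ?_, fun s r t hsr hrt => ?_, fun x => ?_⟩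
    · ext x
      refine tendsto_nhds_unique (hU t s x) (tendsto_const_nhds.congr fun n => ?_)
      have := (hE n).one t s hts

      rw [this]
    · ext x
      refine tendsto_nhds_unique (hU t s x) ?_
      have := tendsto_apply (hU t r) (hU r s x)
      refine this.congr fun n => ?_
      exact (hE n).comp_apply hsr hrt x
    · rw [continuous_iff_continuousAt]
      intro p
      have h1 := (hunif (max (p.1 + 1) 0) (le_max_right _ _) x).continuousOn
        (Eventually.of_forall fun n => ((hE n).cont x).continuousOn).frequently
      refine h1.continuousAt (IsOpen.mem_nhds ?_ ?_)
      · exact isOpen_lt continuous_fst continuous_const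
      · show p.1 < max (p.1 + 1) 0
        exact lt_of_lt_of_le (by linarith) (le_max_left _ _)
  refine ⟨U, hev, fun T0 hT0 => ?_⟩
  obtain ⟨C, hC0, hC⟩ := h.cau hT0
  refine ⟨C, hC0, fun δ hδ s t hs hst ht y => ?_⟩
  have h1 := (tendsto_const_nhds (x := apU T δ t s (K y))).sub (hU t s (K y))
  have h2 : Tendsto (fun m => C * ‖y‖ * (δ + d m) * (t - s)) atTop (𝓝 (C * ‖y‖ * (δ + 0) * (t - s))) :=
    ((hdt.const_add δ).const_mul _).mul_const _
  rw [add_zero] at h2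
  refine le_of_tendsto_of_tendsto h1.norm h2 (Eventually.of_forall fun m => ?_)
  have := hC _ (hd0 m) δ hδ s t hs hst ht y
  rwa [max_eq_left hs]

lemma KD.U_rd (h : KD A D T K a a') {U : ℝ → ℝ → X →L[ℂ] X} (hU : KU A D T K U) {r : ℝ} (hr : 0 ≤ r)
    {x : X} (hx : x ∈ D) : HasDerivWithinAt (fun ρ => U ρ r x) (A r x) (Ici r) r := by
  obtain ⟨y, rfl⟩ := h.surj x hx
  obtain ⟨C, hC0, hC⟩ := hU.conv (r + 1) (by linarith)
  obtain ⟨Cl, hCl0, hCl⟩ := (h.sc (r + 1)).lip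
  rw [rd_iff, Metric.tendsto_nhds]
  intro ε hε
  set B := C * ‖y‖ + Cl * ‖y‖ + 1 with hB
  have hBp : 0 < B := by positivity
  set δ := ε / (2 * B) with hδd
  have hδ : 0 < δ := by positivity
  have h1 := apU_diag_rd h.gen hδ hr (h.mem y)
  rw [rd_iff, Metric.tendsto_nhds] at h1
  have hev : ∀ᶠ h in 𝓝[>] (0:ℝ), h < 1 := nhdsWithin_le_nhds (gt_mem_nhds one_pos)
  filter_upwards [h1 (ε / 2) (by positivity), hev, self_mem_nhdsWithin] with e h2 he1 he0
  have he0' : 0 < e := he0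
  rw [dist_eq_norm] at *
  have h3 := hC δ hδ r (r + e) hr (by linarith) (by linarith) y
  have t1 := tau_nonneg hδ r
  have t2 := tau_le hδ hr
  have t3 := lt_tau hδ r
  have h4 := (a (tau δ r) - a r).le_of_opNorm_le (hCl r ⟨hr, by linarith⟩ (tau δ r) ⟨t1, by linarith⟩) y
  rw [ContinuousLinearMap.sub_apply, ← h.aeq _ t1, ← h.aeq r hr] at h4
  have h5 : |tau δ r - r| ≤ δ := by rw [abs_sub_comm, abs_of_nonneg (by linarith)]; linarith
  have h6 : ‖e⁻¹ • (apU T δ (r + e) r (K y) - U (r + e) r (K y))‖ ≤ C * ‖y‖ * δ := by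
    rw [norm_smul, norm_inv, Real.norm_eq_abs, abs_of_pos he0', inv_mul_le_iff₀ he0']
    refine h3.trans (le_of_eq (by ring))
  have h7 : Cl * |tau δ r - r| * ‖y‖ ≤ Cl * δ * ‖y‖ := by gcongr
  have h8 : B * δ = ε / 2 := by rw [hδd]; field_simp
  have e1 : e⁻¹ • (U (r + e) r (K y) - U r r (K y)) - A r (K y) =
      (e⁻¹ • (apU T δ (r + e) r (K y) - apU T δ r r (K y)) - A (tau δ r) (K y)) -
      e⁻¹ • (apU T δ (r + e) r (K y) - U (r + e) r (K y)) + (A (tau δ r) (K y) - A r (K y)) := by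
    rw [hU.ev.one r r le_rfl, (apU_ev h.sg hδ).one r r le_rfl]
    simp only [smul_sub]; abel
  rw [e1]
  have h9 := norm_add_le ((e⁻¹ • (apU T δ (r + e) r (K y) - apU T δ r r (K y)) - A (tau δ r) (K y)) -
      e⁻¹ • (apU T δ (r + e) r (K y) - U (r + e) r (K y))) (A (tau δ r) (K y) - A r (K y))
  have h10 := norm_sub_le (e⁻¹ • (apU T δ (r + e) r (K y) - apU T δ r r (K y)) - A (tau δ r) (K y))
      (e⁻¹ • (apU T δ (r + e) r (K y) - U (r + e) r (K y)))
  rw [hB] at h8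
  nlinarith

lemma KD.KU_lip (h : KD A D T K a a') {U : ℝ → ℝ → X →L[ℂ] X} (hU : KU A D T K U) {T0 : ℝ} (hT0 : 0 ≤ T0)
    {H H' F : ℝ → X →L[ℂ] X} (hH : SC1 T0 H H') (hF : ∀ x, ContinuousOn (fun t => F t x) (Icc 0 T0))
    (hHF : ∀ t ∈ Icc 0 T0, ∀ x ∈ D, H t (A t x) = F t x) :
    ∃ C, 0 ≤ C ∧ ∀ t r, 0 ≤ t → t ≤ r → r ≤ T0 → ‖(H r).comp (U r t) - H t‖ ≤ C * (r - t) := by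
  obtain ⟨C1, hC10, hC1⟩ := h.stab T0 hT0
  obtain ⟨Cl, hCl0, hCl⟩ := (h.sc T0).lip
  obtain ⟨Cc, hCc0, hCc⟩ := hU.conv T0 hT0
  obtain ⟨c1, hc10, hc1⟩ := bdd_of_compact isCompact_Icc hH.cont
  obtain ⟨c2, hc20, hc2⟩ := bdd_of_compact isCompact_Icc hH.cont'
  obtain ⟨c3, hc30, hc3⟩ := bdd_of_compact isCompact_Icc hF
  refine ⟨(c2 + c3) * C1, by positivity, fun t r ht htr hr => ?_⟩
  have hrI : r ∈ Icc 0 T0 := ⟨ht.trans htr, hr⟩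
  have main : ∀ y, ‖H r (U r t (K y)) - H t (K y)‖ ≤ (c2 + c3) * C1 * (r - t) * ‖K y‖ := by
    intro y
    have hδ : ∀ δ, 0 < δ → ‖H r (U r t (K y)) - H t (K y)‖ ≤
        ((c2 + c3) * C1 * ‖K y‖ + c1 * Cl * C1 * ‖y‖ * δ) * (r - t) + c1 * (Cc * ‖y‖ * δ * (r - t)) := by
      intro δ hδ
      have hE := apU_ev h.sg hδ
      have h1 := norm_image_sub_le_of_norm_deriv_right_le_segment
        (f := fun ρ => H ρ (apU T δ ρ t (K y)))
        (f' := fun ρ => H' ρ (apU T δ ρ t (K y)) + H ρ (A (tau δ ρ) (apU T δ ρ t (K y))))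
        (C := (c2 + c3) * C1 * ‖K y‖ + c1 * Cl * C1 * ‖y‖ * δ) (a := t) (b := r)
        (continuousOn_apply (fun x => (hH.cont x).mono (Icc_subset_Icc ht hr))
          (hE.cont_left t _).continuousOn)
        (fun ρ hρ => hH.rd_apply ⟨ht.trans hρ.1, hρ.2.trans_le hr⟩ (apU_rd h hδ ht hρ.1 (h.mem y)))
        (fun ρ hρ => by
          have hρT : ρ ≤ T0 := hρ.2.le.trans hr
          have hρ0 : 0 ≤ ρ := ht.trans hρ.1
          have hρI : ρ ∈ Icc 0 T0 := ⟨hρ0, hρT⟩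
          obtain ⟨b1, b2⟩ := hC1 δ hδ ρ hρT t
          obtain ⟨z, hz, hzn⟩ := b2 y
          have b3 := (apU T δ ρ t).le_of_opNorm_le b1 (K y)
          have t1 := tau_nonneg hδ ρ
          have t2 := tau_le hδ hρ0
          have t3 := lt_tau hδ ρ
          have h5 : |tau δ ρ - ρ| ≤ δ := by rw [abs_sub_comm, abs_of_nonneg (by linarith)]; linarith
          have e1 : A (tau δ ρ) (apU T δ ρ t (K y)) = A ρ (apU T δ ρ t (K y)) + (a (tau δ ρ) - a ρ) z := by
            rw [hz, h.aeq _ t1, h.aeq _ hρ0]; simp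
          rw [e1, map_add, hHF ρ hρI _ (apU_mem h hδ _ _ (h.mem y))]
          have g1 := (H' ρ).le_of_opNorm_le (hc2 ρ hρI) (apU T δ ρ t (K y))
          have g2 := (F ρ).le_of_opNorm_le (hc3 ρ hρI) (apU T δ ρ t (K y))
          have g3 := (H ρ).le_of_opNorm_le (hc1 ρ hρI) ((a (tau δ ρ) - a ρ) z)
          have g4 := (a (tau δ ρ) - a ρ).le_of_opNorm_le (hCl ρ hρI _ ⟨t1, t2.trans hρT⟩) z
          have g5 : ‖(a (tau δ ρ) - a ρ) z‖ ≤ Cl * δ * (C1 * ‖y‖) := by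
            refine g4.trans ?_
            gcongr
          have n1 := norm_add_le (H' ρ (apU T δ ρ t (K y))) (F ρ (apU T δ ρ t (K y)) + H ρ ((a (tau δ ρ) - a ρ) z))
          have n2 := norm_add_le (F ρ (apU T δ ρ t (K y))) (H ρ ((a (tau δ ρ) - a ρ) z))
          have m1 : c2 * ‖apU T δ ρ t (K y)‖ ≤ c2 * (C1 * ‖K y‖) := by gcongr
          have m2 : c3 * ‖apU T δ ρ t (K y)‖ ≤ c3 * (C1 * ‖K y‖) := by gcongr
          have m3 : c1 * ‖(a (tau δ ρ) - a ρ) z‖ ≤ c1 * (Cl * δ * (C1 * ‖y‖)) := by gcongr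
          calc _ ≤ c2 * (C1 * ‖K y‖) + (c3 * (C1 * ‖K y‖) + c1 * (Cl * δ * (C1 * ‖y‖))) := by linarith
            _ = _ := by ring)
        r (right_mem_Icc.2 htr)
      simp only [hE.one t t le_rfl, ContinuousLinearMap.one_apply] at h1
      have h2 := hCc δ hδ t r ht htr hr y
      have h3 := (H r).le_of_opNorm_le (hc1 r hrI) (apU T δ r t (K y) - U r t (K y))
      have h4 : c1 * ‖apU T δ r t (K y) - U r t (K y)‖ ≤ c1 * (Cc * ‖y‖ * δ * (r - t)) := by gcongr
      have e : H r (U r t (K y)) - H t (K y) = (H r (apU T δ r t (K y)) - H t (K y)) -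
        H r (apU T δ r t (K y) - U r t (K y)) := by simp only [map_sub]; abel
      rw [e]
      have := norm_sub_le (H r (apU T δ r t (K y)) - H t (K y)) (H r (apU T δ r t (K y) - U r t (K y)))
      linarith
    have hlim : Tendsto (fun δ => ((c2 + c3) * C1 * ‖K y‖ + c1 * Cl * C1 * ‖y‖ * δ) * (r - t) +
        c1 * (Cc * ‖y‖ * δ * (r - t))) (𝓝[>] (0:ℝ)) (𝓝 (((c2 + c3) * C1 * ‖K y‖ + c1 * Cl * C1 * ‖y‖ * 0) * (r - t) +
        c1 * (Cc * ‖y‖ * 0 * (r - t)))) :=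
      Tendsto.mono_left (Continuous.tendsto (by fun_prop) 0) nhdsWithin_le_nhds
    have := ge_of_tendsto hlim (by filter_upwards [self_mem_nhdsWithin] with δ hδ' using hδ δ hδ')
    refine this.trans (le_of_eq (by ring))
  have hrt : 0 ≤ r - t := by linarith
  refine ContinuousLinearMap.opNorm_le_bound _ (by positivity) fun x => ?_
  have hcl : IsClosed {x : X | ‖((H r).comp (U r t) - H t) x‖ ≤ (c2 + c3) * C1 * (r - t) * ‖x‖} :=
    isClosed_le (by fun_prop) (by fun_prop)
  have := (hcl.closure_subset_iff (s := (D : Set X))).2 (fun x hx => by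
    obtain ⟨y, rfl⟩ := h.surj x hx
    exact main y)
  exact this (h.dense x)

lemma KD.KU_rd (h : KD A D T K a a') {U : ℝ → ℝ → X →L[ℂ] X} (hU : KU A D T K U) {T0 : ℝ}
    {H H' F : ℝ → X →L[ℂ] X} (hH : SC1 T0 H H') (hF : ∀ x, ContinuousOn (fun t => F t x) (Icc 0 T0))
    (hHF : ∀ t ∈ Icc 0 T0, ∀ x ∈ D, H t (A t x) = F t x) {t : ℝ} (ht : t ∈ Ico 0 T0) (x : X) :
    HasDerivWithinAt (fun r => H r (U r t x)) (H' t x + F t x) (Ici t) t := by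
  have hT0 : 0 ≤ T0 := ht.1.trans ht.2.le
  have htI : t ∈ Icc 0 T0 := ⟨ht.1, ht.2.le⟩
  obtain ⟨C, hC0, hC⟩ := h.KU_lip hU hT0 hH hF hHF
  rw [rd_iff]
  have h1 : Tendsto (fun e : ℝ => (e⁻¹ • ((H (t + e)).comp (U (t + e) t) - H t)) x) (𝓝[>] 0) (𝓝 ((H' t + F t) x)) := by
    refine tendsto_of_dense (C := C) ?_ h.dense (fun z hz => ?_) x
    · have hev : ∀ᶠ h in 𝓝[>] (0:ℝ), h < T0 - t := nhdsWithin_le_nhds (gt_mem_nhds (by linarith [ht.2]))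
      filter_upwards [hev, self_mem_nhdsWithin] with e he he0
      have he0' : 0 < e := he0
      have := hC t (t + e) ht.1 (by linarith) (by linarith)
      rw [norm_smul, norm_inv, Real.norm_eq_abs, abs_of_pos he0', inv_mul_le_iff₀ he0']
      refine this.trans (le_of_eq (by ring))
    · have h2 := hH.rd_apply ht (h.U_rd hU ht.1 hz)
      rw [rd_iff] at h2
      simp only [hU.ev.one t t le_rfl, ContinuousLinearMap.one_apply, hHF t htI z hz] at h2
      exact h2
  refine h1.congr fun e => ?_
  rw [hU.ev.one t t le_rfl]
  rfl

end KU
end KP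

set_option linter.unusedSectionVars false
set_option linter.deprecated false
set_option linter.unusedVariables false
namespace KP
open Topology

section Volt
variable {X : Type*} [NormedAddCommGroup X] [NormedSpace ℂ X] [CompleteSpace X]

lemma gronwall_int {s T K C : ℝ} (hC : 0 ≤ C) (hsT : s ≤ T) {φ : ℝ → X} (hφ : ContinuousOn φ (Icc s T))
    (h : ∀ t ∈ Icc s T, ‖φ t‖ ≤ K + C * ∫ r in s..t, ‖φ r‖) :
    ∀ t ∈ Icc s T, ‖φ t‖ ≤ K * Real.exp ((C + 1) * (t - s)) := by
  set ψ : ℝ → ℝ := fun r => ‖φ (projIcc s T hsT r)‖ with hψd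
  have hψ : Continuous ψ := (hφ.restrict.comp continuous_projIcc).norm
  have hψe : ∀ r ∈ Icc s T, ψ r = ‖φ r‖ := fun r hr => by simp [hψd, projIcc_of_mem hsT hr]
  have hie : ∀ t ∈ Icc s T, ∫ r in s..t, ‖φ r‖ = ∫ r in s..t, ψ r := by
    intro t ht
    refine intervalIntegral.integral_congr fun r hr => ?_
    rw [uIcc_of_le ht.1] at hr
    exact (hψe r ⟨hr.1, hr.2.trans ht.2⟩).symm
  have hd : ∀ t, HasDerivAt (fun t => ∫ r in s..t, ψ r) (ψ t) t := fun t => hψ.integral_hasStrictDerivAt s t |>.hasDerivAt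
  have hpos : ∀ t, s ≤ t → 0 ≤ ∫ r in s..t, ψ r := fun t ht =>
    intervalIntegral.integral_nonneg ht fun r _ => norm_nonneg _
  have hg := norm_le_gronwallBound_of_norm_deriv_right_le (f := fun t => ∫ r in s..t, ψ r) (f' := ψ)
    (δ := 0) (K := C + 1) (ε := K) (a := s) (b := T)
    (fun t _ => (hd t).continuousAt.continuousWithinAt) (fun t _ => (hd t).hasDerivWithinAt)
    (by simp) (fun t ht => by
      have htI : t ∈ Icc s T := ⟨ht.1, ht.2.le⟩
      have h1 := h t htI
      rw [hie t htI] at h1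
      have h2 := hpos t ht.1
      rw [Real.norm_of_nonneg h2, show ‖ψ t‖ = ‖φ t‖ by rw [hψe t htI, norm_norm]]
      nlinarith)
  intro t ht
  have h1 := h t ht
  have h2 := hg t ht
  rw [hie t ht] at h1
  rw [Real.norm_of_nonneg (hpos t ht.1), gronwallBound_of_K_ne_0 (by positivity)] at h2
  have h3 := hpos t ht.1
  have h4 : (C + 1) * (∫ r in s..t, ψ r) ≤ K * (Real.exp ((C + 1) * (t - s)) - 1) := by
    have := mul_le_mul_of_nonneg_left h2 (show 0 ≤ C + 1 by positivity)
    refine this.trans (le_of_eq ?_)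
    field_simp
    ring
  nlinarith

variable {E : ℝ → ℝ → X →L[ℂ] X} {G : ℝ → X →L[ℂ] X}

/-- one Picard step -/
def volJ (E : ℝ → ℝ → X →L[ℂ] X) (G : ℝ → X →L[ℂ] X) (v : ℝ × ℝ → X) (p : ℝ × ℝ) : X :=
  ∫ r in p.2..max p.2 p.1, E p.1 r (G r (v (r, p.2)))

lemma param_cont {f : ℝ × ℝ → ℝ → X} (hf : Continuous (Function.uncurry f)) {α β : ℝ × ℝ → ℝ}
    (hα : Continuous α) (hβ : Continuous β) : Continuous (fun p => ∫ r in α p..β p, f p r) := by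
  have h1 := intervalIntegral.continuous_parametric_intervalIntegral_of_continuous (μ := volume) (a₀ := 0) hf hα
  have h2 := intervalIntegral.continuous_parametric_intervalIntegral_of_continuous (μ := volume) (a₀ := 0) hf hβ
  refine (h2.sub h1).congr fun p => ?_
  have hc : Continuous (f p) := hf.comp (by fun_prop : Continuous fun r : ℝ => (p, r))
  exact intervalIntegral.integral_interval_sub_left (hc.intervalIntegrable _ _) (hc.intervalIntegrable _ _)

lemma vol_integrand_cont (hE : Ev E) (hG : ∀ x, Continuous (fun r => G r x)) {v : ℝ × ℝ → X}
    (hv : Continuous v) :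
    Continuous (Function.uncurry (fun (p : ℝ × ℝ) (r : ℝ) => E p.1 r (G r (v (r, p.2))))) := by
  have h1 : Continuous (fun q : (ℝ × ℝ) × ℝ => G q.2 (v (q.2, q.1.2))) :=
    continuous_apply' (G := fun q : (ℝ × ℝ) × ℝ => G q.2) (fun x => (hG x).comp continuous_snd)
      (hv.comp (by fun_prop))
  exact continuous_apply' (G := fun q : (ℝ × ℝ) × ℝ => E q.1.1 q.2)
    (fun x => (hE.cont x).comp (by fun_prop : Continuous (fun q : (ℝ × ℝ) × ℝ => (q.1.1, q.2)))) h1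

lemma volJ_cont (hE : Ev E) (hG : ∀ x, Continuous (fun r => G r x)) {v : ℝ × ℝ → X}
    (hv : Continuous v) : Continuous (volJ E G v) :=
  param_cont (vol_integrand_cont hE hG hv) continuous_snd (by fun_prop)

lemma volterra (hE : Ev E) (hG : ∀ x, Continuous (fun r => G r x)) {k : ℝ × ℝ → X} (hk : Continuous k) :
    ∃ w : ℝ × ℝ → X, Continuous w ∧ ∀ p, w p = k p + volJ E G w p := by
  set v : ℕ → ℝ × ℝ → X := fun n => (volJ E G)^[n] k with hv
  have hvs : ∀ n, v (n + 1) = volJ E G (v n) := fun n => Function.iterate_succ_apply' _ _ _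
  have hvc : ∀ n, Continuous (v n) := by
    intro n
    induction n with
    | zero => exact hk
    | succ n ih => rw [hvs]; exact volJ_cont hE hG ih
  have hbd : ∀ R, 0 ≤ R → ∃ C M, 0 ≤ C ∧ 0 ≤ M ∧ (∀ t ∈ Icc (-R) R, ∀ r ∈ Icc (-R) R, ‖(E t r).comp (G r)‖ ≤ C) ∧
      ∀ n, ∀ p ∈ Icc (-R) R ×ˢ Icc (-R) R, ‖v n p‖ ≤ M * (C * (max p.2 p.1 - p.2)) ^ n / (n.factorial : ℝ) := by
    intro R hR
    obtain ⟨CE, hCE0, hCE⟩ := hE.bdd (-R) R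
    obtain ⟨CG, hCG0, hCG⟩ := bdd_of_compact (isCompact_Icc (a := -R) (b := R)) (fun x => (hG x).continuousOn)
    obtain ⟨M, hM⟩ := ((isCompact_Icc (a := -R) (b := R)).prod (isCompact_Icc (a := -R) (b := R))).exists_bound_of_continuousOn hk.continuousOn
    have hM0 : 0 ≤ M := (norm_nonneg _).trans (hM (0, 0) ⟨⟨by simpa, hR⟩, ⟨by simpa, hR⟩⟩)
    have hEG : ∀ t ∈ Icc (-R) R, ∀ r ∈ Icc (-R) R, ‖(E t r).comp (G r)‖ ≤ CE * CG := fun t ht r hr =>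
      (ContinuousLinearMap.opNorm_comp_le _ _).trans (mul_le_mul (hCE t ht r hr) (hCG r hr) (norm_nonneg _) hCE0)
    refine ⟨CE * CG, M, by positivity, hM0, hEG, fun n => ?_⟩
    induction n with
    | zero => 
      intro p hp
      have h0 : v 0 p = k p := rfl
      rw [h0]
      simpa using hM p hp
    | succ n ih =>
      intro p hp
      rw [hvs]
      set C := CE * CG with hCd
      have hC0 : 0 ≤ C := by positivity
      have hle : p.2 ≤ max p.2 p.1 := le_max_left _ _
      have hder : ∀ r, HasDerivAt (fun r => M * (C * (r - p.2)) ^ (n + 1) / ((n + 1).factorial : ℝ))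
          (C * (M * (C * (r - p.2)) ^ n / (n.factorial : ℝ))) r := by
        intro r
        have h1 : HasDerivAt (fun r => C * (r - p.2)) (C * 1) r :=
          ((hasDerivAt_id r).sub_const p.2).const_mul C
        have h2 := ((h1.fun_pow (n + 1)).const_mul M).div_const ((n + 1).factorial : ℝ)
        refine h2.congr_deriv ?_
        rw [Nat.factorial_succ]
        have : (n.factorial : ℝ) ≠ 0 := by positivity
        have : ((n:ℝ) + 1) ≠ 0 := by positivity
        push_cast
        field_simp
      have hIntg := intervalIntegral.integral_eq_sub_of_hasDerivAt (a := p.2) (b := max p.2 p.1)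
        (fun r _ => hder r) (Continuous.intervalIntegrable (by fun_prop) _ _)
      have := intervalIntegral.norm_integral_le_of_norm_le (μ := volume) hle
        (f := fun r => E p.1 r (G r (v n (r, p.2)))) (g := fun r => C * (M * (C * (r - p.2)) ^ n / (n.factorial : ℝ)))
        (Eventually.of_forall fun r hr => by
          have hrR : r ∈ Icc (-R) R := ⟨hp.2.1.trans hr.1.le, hr.2.trans (max_le hp.2.2 hp.1.2)⟩
          have h1 := ih (r, p.2) ⟨hrR, hp.2⟩
          simp only [max_eq_right hr.1.le] at h1
          have h2 := ((E p.1 r).comp (G r)).le_of_opNorm_le (hEG p.1 hp.1 r hrR) (v n (r, p.2))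
          exact h2.trans (mul_le_mul_of_nonneg_left h1 hC0))
        (Continuous.intervalIntegrable (by fun_prop) _ _)
      rw [hIntg] at this
      simpa [volJ] using this
  have hbd2 : ∀ R, 0 ≤ R → ∃ b : ℕ → ℝ, Summable b ∧ (∀ n, ∀ p ∈ Icc (-R) R ×ˢ Icc (-R) R, ‖v n p‖ ≤ b n) ∧
      ∃ C, 0 ≤ C ∧ (∀ t ∈ Icc (-R) R, ∀ r ∈ Icc (-R) R, ‖(E t r).comp (G r)‖ ≤ C) := by
    intro R hR
    obtain ⟨C, M, hC, hM, h1, h2⟩ := hbd R hR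
    refine ⟨fun n => M * ((C * (2 * R)) ^ n / (n.factorial : ℝ)), (Real.summable_pow_div_factorial _).mul_left M,
      fun n p hp => (h2 n p hp).trans ?_, C, hC, h1⟩
    show _ ≤ M * ((C * (2 * R)) ^ n / (n.factorial : ℝ))
    rw [← mul_div_assoc]
    have h3 : 0 ≤ max p.2 p.1 - p.2 := by linarith [le_max_left p.2 p.1]
    have h4 : max p.2 p.1 - p.2 ≤ 2 * R := by linarith [hp.2.1, max_le hp.2.2 hp.1.2]
    gcongr
  have hin : ∀ p : ℝ × ℝ, ∃ R, 0 ≤ R ∧ p ∈ Ioo (-R) R ×ˢ Ioo (-R) R := by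
    intro p
    refine ⟨|p.1| + |p.2| + 1, by positivity, ⟨?_, ?_⟩, ?_, ?_⟩ <;>
    linarith [neg_abs_le p.1, neg_abs_le p.2, le_abs_self p.1, le_abs_self p.2, abs_nonneg p.1, abs_nonneg p.2]
  have hsub : ∀ R : ℝ, Ioo (-R) R ×ˢ Ioo (-R) R ⊆ Icc (-R) R ×ˢ Icc (-R) R := fun R =>
    prod_mono Ioo_subset_Icc_self Ioo_subset_Icc_self
  have hsum : ∀ p, Summable (fun n => v n p) := by
    intro p
    obtain ⟨R, hR, hp⟩ := hin p
    obtain ⟨b, hb, hvb, -⟩ := hbd2 R hR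
    exact Summable.of_norm_bounded hb (fun n => hvb n p (hsub R hp))
  refine ⟨fun p => ∑' n, v n p, ?_, fun p => ?_⟩
  · rw [continuous_iff_continuousAt]
    intro p
    obtain ⟨R, hR, hp⟩ := hin p
    obtain ⟨b, hb, hvb, -⟩ := hbd2 R hR
    have := continuousOn_tsum (fun n => (hvc n).continuousOn) hb (fun n p hp => hvb n p hp)
    exact this.continuousAt (mem_of_superset ((isOpen_Ioo.prod isOpen_Ioo).mem_nhds hp) (hsub R))
  · obtain ⟨R, hR, hp⟩ := hin p
    obtain ⟨b, hb, hvb, C, hC, hEG⟩ := hbd2 R hR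
    have hp' := hsub R hp
    show (∑' n, v n p) = _
    rw [(hsum p).tsum_eq_zero_add]
    have h0 : v 0 p = k p := rfl
    rw [h0]
    congr 1
    have h1 : HasSum (fun n => v (n + 1) p) (volJ E G (fun p => ∑' n, v n p) p) := by
      simp only [hvs]
      refine intervalIntegral.hasSum_integral_of_dominated_convergence (fun n _ => C * b n) (fun n => ?_)
        (fun n => Eventually.of_forall fun r hr => ?_) (Eventually.of_forall fun r hr => hb.mul_left C)
        (by simp) (Eventually.of_forall fun r hr => ?_)
      · exact ((vol_integrand_cont hE hG (hvc n)).comp (by fun_prop : Continuous fun r : ℝ => (p, r))).aestronglyMeasurable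
      · rw [uIoc_of_le (le_max_left _ _)] at hr
        have hrR : r ∈ Icc (-R) R := ⟨hp'.2.1.trans hr.1.le, hr.2.trans (max_le hp'.2.2 hp'.1.2)⟩
        have h2 := ((E p.1 r).comp (G r)).le_of_opNorm_le (hEG p.1 hp'.1 r hrR) (v n (r, p.2))
        exact h2.trans (mul_le_mul_of_nonneg_left (hvb n _ ⟨hrR, hp'.2⟩) hC)
      · exact ((E p.1 r).comp (G r)).hasSum (hsum (r, p.2)).hasSum
    exact h1.tsum_eq

end Volt
end KP

set_option linter.unusedSectionVars false
set_option linter.deprecated false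
set_option linter.unusedVariables false
namespace KP
open Topology

section Pert
variable {X : Type*} [NormedAddCommGroup X] [NormedSpace ℂ X] [CompleteSpace X]
variable {E : ℝ → ℝ → X →L[ℂ] X} {G : ℝ → X →L[ℂ] X}

lemma Ev.bddG (hE : Ev E) (hG : ∀ x, Continuous (fun r => G r x)) (a b : ℝ) :
    ∃ C, 0 ≤ C ∧ ∀ t ∈ Icc a b, ∀ r ∈ Icc a b, ∀ x, ‖E t r (G r x)‖ ≤ C * ‖x‖ := by
  obtain ⟨CE, hCE0, hCE⟩ := hE.bdd a b
  obtain ⟨CG, hCG0, hCG⟩ := bdd_of_compact (isCompact_Icc (a := a) (b := b)) (fun x => (hG x).continuousOn)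
  refine ⟨CE * CG, by positivity, fun t ht r hr x => ?_⟩
  calc ‖E t r (G r x)‖ ≤ CE * ‖G r x‖ := (E t r).le_of_opNorm_le (hCE t ht r hr) _
    _ ≤ CE * (CG * ‖x‖) := mul_le_mul_of_nonneg_left ((G r).le_of_opNorm_le (hCG r hr) _) hCE0
    _ = _ := by ring

lemma Ev.integrand (hE : Ev E) (hG : ∀ x, Continuous (fun r => G r x)) {φ : ℝ → X} {S : Set ℝ}
    (hφ : ContinuousOn φ S) (t : ℝ) : ContinuousOn (fun r => E t r (G r (φ r))) S :=
  continuousOn_apply (fun x => (hE.cont_right t x).continuousOn)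
    (continuousOn_apply (fun x => (hG x).continuousOn) hφ)

lemma vol_bound (hE : Ev E) (hG : ∀ x, Continuous (fun r => G r x)) {s T : ℝ} (hsT : s ≤ T) :
    ∃ C, 0 ≤ C ∧ ∀ (M : ℝ) (φ k : ℝ → X), ContinuousOn φ (Icc s T) → (∀ t ∈ Icc s T, ‖k t‖ ≤ M) →
      (∀ t ∈ Icc s T, φ t = k t + ∫ r in s..t, E t r (G r (φ r))) → ∀ t ∈ Icc s T, ‖φ t‖ ≤ M * C := by
  obtain ⟨C, hC0, hC⟩ := hE.bddG hG s T
  refine ⟨Real.exp ((C + 1) * (T - s)), (Real.exp_pos _).le, fun M φ k hφ hk h => ?_⟩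
  have hM0 : 0 ≤ M := (norm_nonneg _).trans (hk s (left_mem_Icc.2 hsT))
  have hg := gronwall_int (K := M) hC0 hsT hφ (fun t ht => by
    rw [h t ht]
    refine (norm_add_le _ _).trans (add_le_add (hk t ht) ?_)
    rw [← intervalIntegral.integral_const_mul]
    have hsub : Icc s t ⊆ Icc s T := Icc_subset_Icc_right ht.2
    refine intervalIntegral.norm_integral_le_of_norm_le ht.1 (Eventually.of_forall fun r hr => ?_)
      (((hφ.mono hsub).norm.const_smul C).intervalIntegrable_of_Icc ht.1)
    exact hC t ht r ⟨hr.1.le, hr.2.trans ht.2⟩ _)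
  intro t ht
  refine (hg t ht).trans (mul_le_mul_of_nonneg_left (Real.exp_le_exp.2 ?_) hM0)
  exact mul_le_mul_of_nonneg_left (by linarith [ht.2]) (by positivity)

lemma vol_unique (hE : Ev E) (hG : ∀ x, Continuous (fun r => G r x)) {s T : ℝ} (hsT : s ≤ T)
    {φ ψ k : ℝ → X} (hφ : ContinuousOn φ (Icc s T)) (hψ : ContinuousOn ψ (Icc s T))
    (h1 : ∀ t ∈ Icc s T, φ t = k t + ∫ r in s..t, E t r (G r (φ r)))
    (h2 : ∀ t ∈ Icc s T, ψ t = k t + ∫ r in s..t, E t r (G r (ψ r))) :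
    ∀ t ∈ Icc s T, φ t = ψ t := by
  obtain ⟨C, -, hC⟩ := vol_bound hE hG hsT
  intro t ht
  have := hC 0 (fun t => φ t - ψ t) (fun _ => 0) (hφ.sub hψ) (by simp) (fun t ht => by
    have hsub : Icc s t ⊆ Icc s T := Icc_subset_Icc_right ht.2
    simp only [h1 t ht, h2 t ht]
    simp only [map_sub]
    rw [intervalIntegral.integral_sub (((hE.integrand hG hφ t).mono hsub).intervalIntegrable_of_Icc ht.1)
      (((hE.integrand hG hψ t).mono hsub).intervalIntegrable_of_Icc ht.1)]
    abel) t ht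
  rw [zero_mul] at this
  exact sub_eq_zero.1 (norm_le_zero_iff.1 this)

lemma exists_V (hE : Ev E) (hG : ∀ x, Continuous (fun r => G r x)) :
    ∃ V : ℝ → ℝ → X →L[ℂ] X, Ev V ∧ ∀ x s t, s ≤ t →
      V t s x = E t s x + ∫ r in s..t, E t r (G r (V r s x)) := by
  choose w hwc hw using fun x => volterra hE hG (hE.cont x)
  have hw0 : ∀ x t s, t ≤ s → w x (t, s) = x := by
    intro x t s hts
    rw [hw x (t, s)]
    simp [volJ, max_eq_left hts, hE.one t s hts]
  have hw1 : ∀ x s t, s ≤ t → w x (t, s) = E t s x + ∫ r in s..t, E t r (G r (w x (r, s))) := by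
    intro x s t hst
    rw [hw x (t, s)]
    simp [volJ, max_eq_right hst]
  have hwl : ∀ x s, Continuous (fun t => w x (t, s)) := fun x s =>
    (hwc x).comp (by fun_prop : Continuous (fun t : ℝ => (t, s)))
  have hii : ∀ x s t a b, IntervalIntegrable (fun r => E t r (G r (w x (r, s)))) volume a b := fun x s t a b =>
    (continuousOn_univ.1 (hE.integrand hG (hwl x s).continuousOn t)).intervalIntegrable _ _
  have hadd : ∀ t s x y, w (x + y) (t, s) = w x (t, s) + w y (t, s) := by
    intro t s x y
    rcases le_total t s with h | h
    · simp [hw0 _ _ _ h]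
    · refine vol_unique hE hG h (k := fun t => E t s (x + y)) (φ := fun t => w (x + y) (t, s))
        (ψ := fun t => w x (t, s) + w y (t, s)) (hwl _ _).continuousOn
        ((hwl _ _).add (hwl _ _)).continuousOn (fun t ht => hw1 _ _ _ ht.1) (fun t ht => ?_) t ⟨h, le_rfl⟩
      simp only [map_add]
      rw [intervalIntegral.integral_add (hii _ _ _ _ _) (hii _ _ _ _ _), hw1 x s t ht.1, hw1 y s t ht.1]
      abel
  have hsmul : ∀ t s (c : ℂ) x, w (c • x) (t, s) = c • w x (t, s) := by
    intro t s c x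
    rcases le_total t s with h | h
    · simp [hw0 _ _ _ h]
    · refine vol_unique hE hG h (k := fun t => E t s (c • x)) (φ := fun t => w (c • x) (t, s))
        (ψ := fun t => c • w x (t, s)) (hwl _ _).continuousOn
        ((hwl _ _).const_smul c).continuousOn (fun t ht => hw1 _ _ _ ht.1) (fun t ht => ?_) t ⟨h, le_rfl⟩
      simp only [map_smul]
      rw [intervalIntegral.integral_smul, hw1 x s t ht.1, smul_add]
  have hbd : ∀ t s, ∃ C, ∀ x, ‖w x (t, s)‖ ≤ C * ‖x‖ := by
    intro t s
    rcases le_total t s with h | h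
    · exact ⟨1, fun x => by simp [hw0 _ _ _ h]⟩
    · obtain ⟨C, hC0, hC⟩ := vol_bound hE hG h
      obtain ⟨CE, hCE0, hCE⟩ := hE.bdd s t
      refine ⟨CE * C, fun x => ?_⟩
      have := hC (CE * ‖x‖) (fun t => w x (t, s)) (fun t => E t s x) (hwl _ _).continuousOn
        (fun r hr => (E r s).le_of_opNorm_le (hCE r hr s ⟨le_rfl, h⟩) x) (fun t ht => hw1 _ _ _ ht.1) t ⟨h, le_rfl⟩
      calc _ ≤ _ := this
        _ = _ := by ring
  choose C hC using hbd
  set V : ℝ → ℝ → X →L[ℂ] X := fun t s => LinearMap.mkContinuous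
    { toFun := fun x => w x (t, s), map_add' := hadd t s, map_smul' := hsmul t s } (C t s) (hC t s) with hV
  have hVw : ∀ t s x, V t s x = w x (t, s) := fun t s x => rfl
  refine ⟨V, ⟨fun t s hts => ?_, fun s r t hsr hrt => ?_, fun x => ?_⟩, fun x s t hst => ?_⟩
  · ext x; simp [hVw, hw0 _ _ _ hts]
  · ext x
    show w x (t, s) = w (w x (r, s)) (t, r)
    refine vol_unique hE hG hrt (k := fun t => E t r (w x (r, s))) (φ := fun t => w x (t, s))
        (ψ := fun t => w (w x (r, s)) (t, r)) (hwl _ _).continuousOn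
        (hwl _ _).continuousOn (fun t ht => ?_) (fun t ht => hw1 _ _ _ ht.1) t ⟨hrt, le_rfl⟩
    show w x (t, s) = E t r (w x (r, s)) + ∫ ρ in r..t, E t ρ (G ρ (w x (ρ, s)))
    rw [hw1 x s t (hsr.trans ht.1), hw1 x s r hsr, map_add, hE.comp_apply hsr ht.1,
      ← intervalIntegral.integral_add_adjacent_intervals (hii x s t s r) (hii x s t r t),
      ← ContinuousLinearMap.intervalIntegral_comp_comm _ (hii x s r s r), add_assoc]
    congr 2
    refine intervalIntegral.integral_congr fun ρ hρ => ?_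
    rw [uIcc_of_le hsr] at hρ
    exact (hE.comp_apply hρ.2 ht.1 _).symm
  · exact (hwc x)
  · exact hw1 x s t hst

end Pert
end KP

set_option linter.unusedSectionVars false
set_option linter.deprecated false
set_option linter.unusedVariables false
namespace KP
open Topology

section Reg
variable {X : Type*} [NormedAddCommGroup X] [NormedSpace ℂ X] [CompleteSpace X]
variable {E : ℝ → ℝ → X →L[ℂ] X}

lemma mild_cont (hE : Ev E) {g : ℝ → X} (hg : Continuous g) :
    Continuous (fun p : ℝ × ℝ => E p.1 p.2 (g p.2)) :=
  continuous_apply' (G := fun p : ℝ × ℝ => E p.1 p.2) hE.cont (hg.comp continuous_snd)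

lemma mild_int (hE : Ev E) {g : ℝ → X} (hg : Continuous g) (t : ℝ) :
    Continuous (fun r => E t r (g r)) :=
  (mild_cont hE hg).comp (by fun_prop : Continuous (fun r : ℝ => (t, r)))

lemma mild_rd (hE : Ev E) {g : ℝ → X} (hg : Continuous g) (t : ℝ) :
    HasDerivWithinAt (fun ρ => ∫ r in t..ρ, E ρ r (g r)) (g t) (Ici t) t := by
  rw [rd_iff, Metric.tendsto_nhds]
  intro ε hε
  have h1 := (mild_cont hE hg).tendsto (t, t)
  rw [Metric.tendsto_nhds_nhds] at h1
  obtain ⟨δ, hδ, h2⟩ := h1 (ε / 2) (by positivity)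
  have hev : ∀ᶠ h in 𝓝[>] (0:ℝ), h < δ := nhdsWithin_le_nhds (gt_mem_nhds hδ)
  filter_upwards [hev, self_mem_nhdsWithin] with h hh hh0
  have hh0' : 0 < h := hh0
  have h3 : ∀ r ∈ Set.uIoc t (t + h), ‖E (t + h) r (g r) - g t‖ ≤ ε / 2 := by
    intro r hr
    rw [uIoc_of_le (by linarith)] at hr
    have := h2 (x := (t + h, r)) (by
      rw [Prod.dist_eq, max_lt_iff]
      simp only [Real.dist_eq]
      constructor <;> rw [abs_lt] <;> constructor <;> linarith [hr.1, hr.2])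
    simp only [hE.one t t le_rfl] at this
    rw [← dist_eq_norm]
    exact this.le
  have h4 := intervalIntegral.norm_integral_le_of_norm_le_const h3
  rw [intervalIntegral.integral_sub ((mild_int hE hg _).intervalIntegrable _ _) (by simp),
    intervalIntegral.integral_const] at h4
  rw [dist_eq_norm]
  simp only [intervalIntegral.integral_same, sub_zero]
  have h5 : h⁻¹ • (∫ r in t..(t + h), E (t + h) r (g r)) - g t =
      h⁻¹ • ((∫ r in t..(t + h), E (t + h) r (g r)) - (t + h - t) • g t) := by
    rw [smul_sub, smul_smul]
    congr 1
    rw [add_sub_cancel_left, inv_mul_cancel₀ hh0'.ne', one_smul]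
  rw [h5, norm_smul, Real.norm_of_nonneg (by positivity)]
  rw [add_sub_cancel_left, abs_of_pos hh0'] at h4
  rw [add_sub_cancel_left]
  calc _ ≤ h⁻¹ * (ε / 2 * h) := by gcongr
    _ = ε / 2 := by field_simp
    _ < ε := by linarith

lemma mild_cocycle (hE : Ev E) {g φ : ℝ → X} (hg : Continuous g) {s : ℝ} {w0 : X}
    (hφ : ∀ t, s ≤ t → φ t = E t s w0 + ∫ r in s..t, E t r (g r)) {t ρ : ℝ} (hst : s ≤ t) (htρ : t ≤ ρ) :
    φ ρ = E ρ t (φ t) + ∫ r in t..ρ, E ρ r (g r) := by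
  have hii : ∀ t a b, IntervalIntegrable (fun r => E t r (g r)) volume a b := fun t a b =>
    (mild_int hE hg t).intervalIntegrable _ _
  rw [hφ ρ (hst.trans htρ), hφ t hst, map_add, hE.comp_apply hst htρ,
    ← intervalIntegral.integral_add_adjacent_intervals (hii ρ s t) (hii ρ t ρ),
    ← ContinuousLinearMap.intervalIntegral_comp_comm _ (hii t s t), add_assoc]
  congr 2
  refine intervalIntegral.integral_congr fun r hr => ?_
  rw [uIcc_of_le hst] at hr
  exact (hE.comp_apply hr.2 htρ _).symm

/-- clamp to `[0,T]` -/
def cl (T r : ℝ) : ℝ := max 0 (min r T)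

lemma cl_cont (T : ℝ) : Continuous (cl T) := by unfold cl; fun_prop
lemma cl_mem {T : ℝ} (hT : 0 ≤ T) (r : ℝ) : cl T r ∈ Icc 0 T :=
  ⟨le_max_left _ _, max_le hT (min_le_right _ _)⟩
lemma cl_eq {T r : ℝ} (hr : r ∈ Icc 0 T) : cl T r = r := by
  rw [cl, min_eq_left hr.2, max_eq_right hr.1]
lemma cl_comp {Y : Type*} [TopologicalSpace Y] {f : ℝ → Y} {T : ℝ} (hT : 0 ≤ T) (hf : ContinuousOn f (Icc 0 T)) :
    Continuous (fun r => f (cl T r)) := hf.comp_continuous (cl_cont T) (cl_mem hT)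

variable {A : ℝ → X →ₗ[ℂ] X} {D : Submodule ℂ X} {T : ℝ → ℝ → X →L[ℂ] X} {K : X →L[ℂ] X}
  {a a' : ℝ → X →L[ℂ] X} {U : ℝ → ℝ → X →L[ℂ] X}

lemma KD.regular (h : KD A D T K a a') (hU : KU A D T K U) {T0 : ℝ} {P P' : ℝ → X →L[ℂ] X}
    (hP : SC1 T0 P P') {f f' : ℝ → X} (hf : ContinuousOn f (Icc 0 T0)) (hf' : ContinuousOn f' (Icc 0 T0))
    (hfd : ∀ t ∈ Ico 0 T0, HasDerivWithinAt f (f' t) (Ici t) t) {s : ℝ} (hs : s ∈ Icc 0 T0)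
    {x : X} (hx : x ∈ D) :
    ∃ u : ℝ → X, u s = x ∧ ContinuousOn u (Icc s T0) ∧ ContinuousOn (fun t => A t (u t)) (Icc s T0) ∧
      (∀ t ∈ Icc s T0, u t ∈ D) ∧
      ∀ t ∈ Ico s T0, HasDerivWithinAt u (A t (u t) + P t (u t) + f t) (Ici t) t := by
  have hT0 : 0 ≤ T0 := hs.1.trans hs.2
  have hsub : Icc s T0 ⊆ Icc 0 T0 := Icc_subset_Icc_left hs.1
  obtain ⟨Cp, hCp, hPb⟩ := bdd_of_compact isCompact_Icc hP.cont
  obtain ⟨μ, hμ, hun⟩ := h.unitμ hT0 hCp hPb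
  set L : ℝ → X →L[ℂ] X := fun t => μ • K - a t - (P t).comp K with hLd
  obtain ⟨L', hL⟩ : ∃ L', SC1 T0 L L' := ⟨_, ((SC1.const T0 (μ • K)).sub (h.sc T0)).sub (hP.comp (SC1.const T0 K))⟩
  set I : ℝ → X →L[ℂ] X := fun t => Ring.inverse (L t) with hId
  have hI : SC1 T0 I (fun t => - (I t).comp ((L' t).comp (I t))) := hL.inv hun
  have hIL : ∀ t ∈ Icc 0 T0, ∀ y, I t (L t y) = y := fun t ht y => inv_left (hun t ht) y
  have hLI : ∀ t ∈ Icc 0 T0, ∀ y, L t (I t y) = y := fun t ht y => inv_right (hun t ht) y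
  set H : ℝ → X →L[ℂ] X := fun t => K.comp (I t) with hHd
  set H' : ℝ → X →L[ℂ] X := fun t => -(H t).comp ((L' t).comp (I t)) with hH'd
  have hH : SC1 T0 H H' := by
    have h1 := (SC1.const T0 K).comp hI
    refine ⟨h1.cont, fun x => ?_, fun x t ht => ?_⟩
    · refine (h1.cont' x).congr fun t ht => ?_
      simp [hH'd, hHd]
    · refine (h1.rd x t ht).congr_deriv ?_
      simp [hH'd, hHd]
  set F : ℝ → X →L[ℂ] X := fun t => μ • H t - (H t).comp (P t) - 1 with hFd
  have hF : ∀ x, ContinuousOn (fun t => F t x) (Icc 0 T0) := fun x =>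
    (((hH.cont x).const_smul μ).sub (continuousOn_apply hH.cont (hP.cont x))).sub continuousOn_const
  have hHF : ∀ t ∈ Icc 0 T0, ∀ x ∈ D, H t (A t x) = F t x := by
    intro t ht x hx
    obtain ⟨y, rfl⟩ := h.surj x hx
    have h1 : L t y = μ • K y - a t y - P t (K y) := by simp [hLd]
    have h2 := hIL t ht y
    rw [h1, map_sub, map_sub, map_real_smul] at h2
    have h3 := congrArg K h2
    rw [map_sub, map_sub, map_real_smul] at h3
    rw [h.aeq t ht.1]
    simp only [hFd, hHd, ContinuousLinearMap.sub_apply, ContinuousLinearMap.smul_apply,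
      ContinuousLinearMap.comp_apply, ContinuousLinearMap.one_apply]
    rw [sub_eq_iff_eq_add, sub_eq_iff_eq_add] at h3
    rw [h3]
    abel
  set G : ℝ → X →L[ℂ] X := fun t => P t + (L' t).comp (I t) with hGd
  have hG : ∀ x, ContinuousOn (fun t => G t x) (Icc 0 T0) := fun x =>
    (hP.cont x).add (continuousOn_apply (G := L') hL.cont' (hI.cont x))
  set g0 : ℝ → X := fun t => L' t (I t (f t)) + μ • f t - f' t with hg0d
  have hg0 : ContinuousOn g0 (Icc 0 T0) :=
    ((continuousOn_apply hL.cont' (continuousOn_apply hI.cont hf)).add (hf.const_smul μ)).sub hf'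
  obtain ⟨ys, rfl⟩ := h.surj x hx
  set ws : X := L s ys - f s with hws
  set gt : ℝ → X := fun r => g0 (cl T0 r) with hgt
  have hgtc : Continuous gt := cl_comp hT0 hg0
  set Gt : ℝ → X →L[ℂ] X := fun r => G (cl T0 r) with hGt
  have hGtc : ∀ x, Continuous (fun r => Gt r x) := fun x => cl_comp hT0 (hG x)
  have hk : Continuous (fun p : ℝ × ℝ => U p.1 s ws + ∫ r in s..max s p.1, U p.1 r (gt r)) := by
    refine ((hU.ev.cont_left s ws).comp continuous_fst).add ?_
    refine param_cont (f := fun p r => U p.1 r (gt r)) ?_ continuous_const (by fun_prop)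
    exact (mild_cont hU.ev hgtc).comp (by fun_prop : Continuous (fun q : (ℝ × ℝ) × ℝ => (q.1.1, q.2)))
  obtain ⟨w2, hw2c, hw2⟩ := volterra hU.ev hGtc hk
  set w : ℝ → X := fun t => w2 (t, s) with hwd
  have hwc : Continuous w := hw2c.comp (by fun_prop : Continuous (fun t : ℝ => (t, s)))
  set g : ℝ → X := fun r => Gt r (w r) + gt r with hgd
  have hGw : Continuous (fun r => Gt r (w r)) := continuous_apply' hGtc hwc
  have hgc : Continuous g := hGw.add hgtc
  have hw : ∀ t, s ≤ t → w t = U t s ws + ∫ r in s..t, U t r (g r) := by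
    intro t hst
    show w2 (t, s) = _
    rw [hw2 (t, s)]
    simp only [volJ, max_eq_right hst, hgd, map_add]
    rw [intervalIntegral.integral_add ((mild_int hU.ev hGw t).intervalIntegrable _ _)
      ((mild_int hU.ev hgtc t).intervalIntegrable _ _)]
    abel
  have hwss : w s = ws := by rw [hw s le_rfl]; simp [hU.ev.one s s le_rfl]
  have hge : ∀ t ∈ Icc 0 T0, g t = P t (w t) + L' t (I t (w t)) + (L' t (I t (f t)) + μ • f t - f' t) := by
    intro t ht
    simp [hgd, hGt, hgt, cl_eq ht, hGd, hg0d]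
  have hrdw : ∀ t ∈ Ico s T0, HasDerivWithinAt (fun r => H r (w r)) (H' t (w t) + F t (w t) + H t (g t)) (Ici t) t := by
    intro t ht
    have ht0 : t ∈ Ico 0 T0 := ⟨hs.1.trans ht.1, ht.2⟩
    have h1 := h.KU_rd hU hH hF hHF ht0 (w t)
    have h2 := hH.rd_apply ht0 (mild_rd hU.ev hgc t)
    have h3 := h1.add h2
    simp only [intervalIntegral.integral_same, map_zero, zero_add] at h3
    refine h3.congr (fun ρ hρ => ?_) ?_
    · rw [mild_cocycle hU.ev hgc hw ht.1 hρ, map_add]; rfl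
    · simp [hU.ev.one t t le_rfl]
  set u : ℝ → X := fun t => K (I t (w t + f t)) with hud
  have hAu : ∀ t ∈ Icc s T0, A t (u t) = a t (I t (w t + f t)) := fun t ht => h.aeq t (hsub ht).1 _
  have hwf : ContinuousOn (fun t => I t (w t + f t)) (Icc 0 T0) :=
    continuousOn_apply hI.cont (hwc.continuousOn.add hf)
  refine ⟨u, ?_, (K.continuous.comp_continuousOn hwf).mono hsub, ?_, fun t ht => h.mem _, fun t ht => ?_⟩
  · simp only [hud, hwss, hws, sub_add_cancel]
    rw [hIL s hs]
  · exact (((continuousOn_apply (h.sc T0).cont hwf).mono hsub)).congr hAu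
  · have ht0 : t ∈ Ico 0 T0 := ⟨hs.1.trans ht.1, ht.2⟩
    have htI : t ∈ Icc 0 T0 := ⟨ht0.1, ht0.2.le⟩
    have h1 := (hrdw t ht).add (hH.rd_apply ht0 (hfd t ht0))
    have h2 : u = fun r => H r (w r) + H r (f r) := by
      funext r; simp [hud, hHd]
    have h3 : L t (I t (w t + f t)) = w t + f t := hLI t htI _
    have h4 : A t (u t) + P t (u t) + f t = μ • u t - w t := by
      rw [hAu t ⟨ht.1, ht.2.le⟩]
      have h5 : μ • u t - a t (I t (w t + f t)) - P t (u t) = w t + f t := by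
        refine Eq.trans ?_ h3
        rfl
      rw [sub_eq_iff_eq_add, sub_eq_iff_eq_add] at h5
      rw [h5]; abel
    rw [h4, h2]
    refine h1.congr_deriv ?_
    rw [hge t htI]
    simp only [hFd, hH'd, ContinuousLinearMap.sub_apply, ContinuousLinearMap.smul_apply, ContinuousLinearMap.neg_apply,
      ContinuousLinearMap.comp_apply, ContinuousLinearMap.one_apply, map_add, map_sub, map_real_smul, smul_add]
    abel

end Reg
end KP

set_option linter.unusedSectionVars false
set_option linter.deprecated false
set_option linter.unusedVariables false
namespace KP
open Topology

section Pert2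
variable {X : Type*} [NormedAddCommGroup X] [NormedSpace ℂ X] [CompleteSpace X]

lemma contOn_Ici {Y : Type*} [TopologicalSpace Y] {f : ℝ → Y} {s : ℝ}
    (h : ∀ T, s ≤ T → ContinuousOn f (Icc s T)) : ContinuousOn f (Ici s) := by
  intro t ht
  have ht' : s ≤ t := ht
  refine (h (t + 1) (by linarith) t ⟨ht, by linarith⟩).mono_of_mem_nhdsWithin ?_
  exact inter_mem self_mem_nhdsWithin (nhdsWithin_le_nhds (Iic_mem_nhds (by linarith)))

lemma two_sided {x y : ℝ → X} {s : ℝ} (hx : ContinuousOn x (Ici s)) (hy : ContinuousOn y (Ici s))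
    (hd : ∀ t, s ≤ t → HasDerivWithinAt x (y t) (Ici t) t) {t : ℝ} (ht : s < t) : HasDerivAt x (y t) t := by
  have hyc : Continuous (fun r => y (max s r)) :=
    hy.comp_continuous (by fun_prop) (fun r => mem_Ici.2 (le_max_left _ _))
  have hxe : ∀ r, s ≤ r → x r = x s + ∫ ρ in s..r, y (max s ρ) := by
    intro r hr
    have := intervalIntegral.integral_eq_sub_of_hasDeriv_right_of_le hr (f := x) (f' := fun ρ => y (max s ρ))
      (hx.mono Icc_subset_Ici_self)
      (fun ρ hρ => by
        rw [max_eq_right hρ.1.le]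
        exact (hd ρ hρ.1.le).mono Ioi_subset_Ici_self)
      (hyc.intervalIntegrable _ _)
    rw [this]; abel
  have h1 : HasDerivAt (fun r => x s + ∫ ρ in s..r, y (max s ρ)) (y (max s t)) t :=
    ((hyc.integral_hasStrictDerivAt s t).hasDerivAt).const_add _
  rw [max_eq_right ht.le] at h1
  refine h1.congr_of_eventuallyEq ?_
  filter_upwards [Ioi_mem_nhds ht] with r hr
  exact hxe r (le_of_lt hr)

variable {A : ℝ → X →ₗ[ℂ] X} {D : Submodule ℂ X} {T : ℝ → ℝ → X →L[ℂ] X} {K : X →L[ℂ] X}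
  {a a' : ℝ → X →L[ℂ] X} {U : ℝ → ℝ → X →L[ℂ] X}

/-- the perturbed evolution family -/
structure PV (A : ℝ → X →ₗ[ℂ] X) (D : Submodule ℂ X) (P : ℝ → X →L[ℂ] X)
    (V : ℝ → ℝ → X →L[ℂ] X) : Prop where
  ev : Ev V
  rd : ∀ r, 0 ≤ r → ∀ x ∈ D, HasDerivWithinAt (fun ρ => V ρ r x) (A r x + P r x) (Ici r) r
  sol : ∀ f f' : ℝ → X, ContinuousOn f (Ici 0) → ContinuousOn f' (Ici 0) →
    (∀ t, 0 ≤ t → HasDerivWithinAt f (f' t) (Ici t) t) → ∀ s, 0 ≤ s → ∀ x ∈ D, ∀ T0, s ≤ T0 →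
    ∃ u : ℝ → X, (∀ t ∈ Icc s T0, u t = V t s x + ∫ r in s..t, V t r (f r)) ∧
      ContinuousOn u (Icc s T0) ∧ ContinuousOn (fun t => A t (u t)) (Icc s T0) ∧
      (∀ t ∈ Icc s T0, u t ∈ D) ∧
      ∀ t ∈ Ico s T0, HasDerivWithinAt u (A t (u t) + P t (u t) + f t) (Ici t) t

lemma KD.exists_PV (h : KD A D T K a a') {P P' : ℝ → X →L[ℂ] X} (hP : ∀ T0, SC1 T0 P P') :
    ∃ V, PV A D P V := by
  obtain ⟨U, hU⟩ := h.exists_U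
  have hPc : ∀ x, ContinuousOn (fun t => P t x) (Ici 0) := fun x => contOn_Ici fun T0 _ => (hP T0).cont x
  have hG : ∀ x, Continuous (fun r => P (max 0 r) x) := fun x =>
    (hPc x).comp_continuous (by fun_prop) (fun r => mem_Ici.2 (le_max_left _ _))
  obtain ⟨V, hV, hVe⟩ := exists_V (G := fun r => P (max 0 r)) hU.ev hG
  have hrd : ∀ r, 0 ≤ r → ∀ x ∈ D, HasDerivWithinAt (fun ρ => V ρ r x) (A r x + P r x) (Ici r) r := by
    intro s hs x hx
    have hsT : s ≤ s + 1 := by linarith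
    obtain ⟨u, hus, huc, hAu, huD, hud⟩ := h.regular hU (hP (s + 1)) (f := fun _ => 0) (f' := fun _ => 0)
      continuousOn_const continuousOn_const (fun t _ => hasDerivWithinAt_const _ _ _) (s := s) ⟨hs, hsT⟩ hx
    have h1 : ∀ t ∈ Icc s (s + 1), u t = U t s x + ∫ r in s..t, U t r (P (max 0 r) (u r)) := by
      intro t ht
      have hsub : Icc s t ⊆ Icc s (s + 1) := Icc_subset_Icc_right ht.2
      rw [← hus]
      refine hU.ev.duhamel (u := u) (u' := fun t => A t (u t) + P t (u t) + 0) (b := fun t => A t (u t)) ht.1 (huc.mono hsub)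
        (continuousOn_apply (G := fun r => P (max 0 r)) (fun x => (hG x).continuousOn) (huc.mono hsub))
        (fun r hr => hud r ⟨hr.1.le, hr.2.trans_le ht.2⟩)
        (fun r hr => h.U_rd hU (hs.trans hr.1.le) (huD r ⟨hr.1.le, hr.2.le.trans ht.2⟩)) (fun r hr => ?_)
      rw [max_eq_right (hs.trans hr.1.le)]
      abel
    have h2 := vol_unique hU.ev hG hsT huc (hV.cont_left s x).continuousOn h1 (fun t ht => hVe x s t ht.1)
    have h3 := hud s ⟨le_rfl, by linarith⟩
    rw [hus, add_zero] at h3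
    refine h3.congr_of_eventuallyEq ?_ ?_
    · filter_upwards [Icc_mem_nhdsGE (show s < s + 1 by linarith)] with t ht
      exact (h2 t ht).symm
    · exact (h2 s ⟨le_rfl, hsT⟩).symm
  refine ⟨V, hV, hrd, fun f f' hf hf' hfd s hs x hx T0 hsT => ?_⟩
  obtain ⟨u, hus, huc, hAu, huD, hud⟩ := h.regular hU (hP T0) (f := f) (f' := f')
      (hf.mono Icc_subset_Ici_self) (hf'.mono Icc_subset_Ici_self) (fun t ht => hfd t ht.1) (s := s) ⟨hs, hsT⟩ hx
  refine ⟨u, fun t ht => ?_, huc, hAu, huD, hud⟩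
  have hsub : Icc s t ⊆ Icc s T0 := Icc_subset_Icc_right ht.2
  rw [← hus]
  refine hV.duhamel (u := u) (u' := fun t => A t (u t) + P t (u t) + f t) (b := fun t => A t (u t) + P t (u t)) ht.1 (huc.mono hsub)
    (hf.mono (Icc_subset_Ici_self.trans (Ici_subset_Ici.2 hs)))
    (fun r hr => hud r ⟨hr.1.le, hr.2.trans_le ht.2⟩)
    (fun r hr => hrd r (hs.trans hr.1.le) _ (huD r ⟨hr.1.le, hr.2.le.trans ht.2⟩)) (fun r hr => ?_)
  abel

lemma PV.sol' {P : ℝ → X →L[ℂ] X} {V : ℝ → ℝ → X →L[ℂ] X} (h : PV A D P V) {f f' : ℝ → X}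
    (hf : ContinuousOn f (Ici 0)) (hf' : ContinuousOn f' (Ici 0))
    (hfd : ∀ t, 0 ≤ t → HasDerivWithinAt f (f' t) (Ici t) t) {s : ℝ} (hs : 0 ≤ s) {x : X} (hx : x ∈ D)
    {z : ℝ → X} (hz : ∀ t, s ≤ t → z t = V t s x + ∫ r in s..t, V t r (f r)) :
    z s = x ∧ ContinuousOn z (Ici s) ∧ ContinuousOn (fun t => A t (z t)) (Ici s) ∧ (∀ t, s ≤ t → z t ∈ D) ∧
      ∀ t, s ≤ t → HasDerivWithinAt z (A t (z t) + P t (z t) + f t) (Ici t) t := by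
  have key := h.sol f f' hf hf' hfd s hs x hx
  refine ⟨?_, contOn_Ici fun T0 hT0 => ?_, contOn_Ici fun T0 hT0 => ?_, fun t ht => ?_, fun t ht => ?_⟩
  · rw [hz s le_rfl]; simp [h.ev.one s s le_rfl]
  · obtain ⟨u, hu, huc, hAu, huD, hud⟩ := key T0 hT0
    exact huc.congr fun t ht => by rw [hu t ht, hz t ht.1]
  · obtain ⟨u, hu, huc, hAu, huD, hud⟩ := key T0 hT0
    exact hAu.congr fun t ht => by simp only [hu t ht, hz t ht.1]
  · obtain ⟨u, hu, huc, hAu, huD, hud⟩ := key t ht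
    have := huD t ⟨ht, le_rfl⟩
    rwa [hu t ⟨ht, le_rfl⟩, ← hz t ht] at this
  · obtain ⟨u, hu, huc, hAu, huD, hud⟩ := key (t + 1) (by linarith)
    have h1 : ∀ r ∈ Icc s (t + 1), z r = u r := fun r hr => by rw [hu r hr, hz r hr.1]
    have h2 := hud t ⟨ht, by linarith⟩
    rw [h1 t ⟨ht, by linarith⟩]
    refine h2.congr_of_eventuallyEq ?_ (h1 t ⟨ht, by linarith⟩)
    filter_upwards [Icc_mem_nhdsGE (show t < t + 1 by linarith)] with r hr
    exact h1 r ⟨ht.trans hr.1, hr.2⟩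

lemma PV.uniq {P : ℝ → X →L[ℂ] X} {V : ℝ → ℝ → X →L[ℂ] X} (h : PV A D P V) {f : ℝ → X}
    (hf : ContinuousOn f (Ici 0)) {s : ℝ} (hs : 0 ≤ s)
    {z : ℝ → X} (hzc : ContinuousOn z (Ici s)) (hzD : ∀ t, s ≤ t → z t ∈ D)
    (hd : ∀ t, s < t → HasDerivWithinAt z (A t (z t) + P t (z t) + f t) (Ici t) t) :
    ∀ t, s ≤ t → z t = V t s (z s) + ∫ r in s..t, V t r (f r) := by
  intro t ht
  refine h.ev.duhamel (u := z) (u' := fun t => A t (z t) + P t (z t) + f t) (b := fun t => A t (z t) + P t (z t)) ht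
    (hzc.mono Icc_subset_Ici_self)
    (hf.mono (Icc_subset_Ici_self.trans (Ici_subset_Ici.2 hs)))
    (fun r hr => hd r hr.1)
    (fun r hr => h.rd r (hs.trans hr.1.le) _ (hzD r hr.1.le)) (fun r hr => ?_)
  abel

lemma exists_KD_of_kato {domA : ℝ → Submodule ℂ X} (hA : NBCS.KatoClass A domA D) :
    ∃ T K a a', KD A D T K a a' := by
  obtain ⟨⟨N, hN, hl, hg⟩, hdom, hsm⟩ := hA
  have hg' : ∀ t, ∃ T : ℝ → X →L[ℂ] X, 0 ≤ t → NBCS.IsGenerator (A t) D T ∧ ∀ h, 0 ≤ h → ∀ x : X, N t (T h x) ≤ N t x := by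
    intro t
    by_cases ht : 0 ≤ t
    · obtain ⟨T, hT⟩ := hg t ht
      rw [hdom t ht] at hT
      exact ⟨T, fun _ => hT⟩
    · exact ⟨fun _ => 0, fun h => absurd h ht⟩
  choose T hT using hg'
  exact ⟨T, KS.exists_KD ⟨hN, hl, fun t ht => (hT t ht).1, fun t ht => (hT t ht).2, hsm⟩⟩

end Pert2
end KP

set_option linter.unusedSectionVars false
set_option linter.deprecated false
set_option linter.unusedVariables false
namespace KP
open Topology

section Fin
variable {X : Type*} [NormedAddCommGroup X] [NormedSpace ℂ X] [CompleteSpace X]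
variable {A : ℝ → X →ₗ[ℂ] X} {D : Submodule ℂ X} {V : ℝ → ℝ → X →L[ℂ] X}

/-- the data of the similarity transformation -/
structure QD (q qi q' : ℝ → X →L[ℂ] X) : Prop where
  left : ∀ t x, qi t (q t x) = x
  right : ∀ t x, q t (qi t x) = x
  sc : ∀ T, SC1 T q q'
  sci : ∀ T, SC1 T qi (fun t => -(qi t).comp ((q' t).comp (qi t)))

variable {q qi q' : ℝ → X →L[ℂ] X}

lemma QD.c (h : QD q qi q') (x : X) : ContinuousOn (fun t => q t x) (Ici 0) :=
  contOn_Ici fun T _ => (h.sc T).cont x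
lemma QD.c' (h : QD q qi q') (x : X) : ContinuousOn (fun t => q' t x) (Ici 0) :=
  contOn_Ici fun T _ => (h.sc T).cont' x
lemma QD.ci (h : QD q qi q') (x : X) : ContinuousOn (fun t => qi t x) (Ici 0) :=
  contOn_Ici fun T _ => (h.sci T).cont x

lemma QD.exists_of {Q : ℝ → X ≃L[ℂ] X}
    (hQ : ∀ x : X, ContDiffOn ℝ 2 (fun t => (Q t : X →L[ℂ] X) x) (Set.Ici (0:ℝ))) :
    ∃ q' q'', QD (fun t => (Q t : X →L[ℂ] X)) (fun t => ((Q t).symm : X →L[ℂ] X)) q' ∧ ∀ T, SC1 T q' q'' := by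
  obtain ⟨q', hq', hqd⟩ := sc1_of_contDiffOn (G := fun t => (Q t : X →L[ℂ] X))
    (fun x => (hQ x).of_le (by norm_num))
  obtain ⟨q'', hq'', -⟩ := sc1_of_contDiffOn (G := q') (fun x => by
    have h1 := hQ x
    rw [show (2 : WithTop ℕ∞) = 1 + 1 by norm_num, contDiffOn_succ_iff_derivWithin (uniqueDiffOn_Ici 0)] at h1
    exact h1.2.2.congr fun t ht => hqd x t ht)
  refine ⟨q', q'', ⟨fun t x => by simp, fun t x => by simp, hq', fun T => ?_⟩, hq''⟩
  have hu : ∀ t, IsUnit ((Q t : X →L[ℂ] X)) := fun t =>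
    ⟨⟨(Q t : X →L[ℂ] X), ((Q t).symm : X →L[ℂ] X), by ext x; simp, by ext x; simp⟩, rfl⟩
  have hi : ∀ t, Ring.inverse (Q t : X →L[ℂ] X) = ((Q t).symm : X →L[ℂ] X) := by
    intro t
    ext x
    have := inv_left (hu t) ((Q t).symm x)
    simpa using this
  have := (hq' T).inv (fun t _ => hu t)
  simpa only [hi] using this

lemma main_exists (hq : QD q qi q') (hV : PV A D (fun t => (q' t).comp (qi t)) V) {F F' : ℝ → X}
    (hF : ContinuousOn F (Ici 0)) (hF' : ContinuousOn F' (Ici 0))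
    (hFd : ∀ t, 0 ≤ t → HasDerivWithinAt F (F' t) (Ici t) t) {s : ℝ} (hs : 0 ≤ s) {xs : X} (hx : q s xs ∈ D) :
    NBCS.IsClassicalSolution (fun t => (qi t : X →ₗ[ℂ] X) ∘ₗ (A t ∘ₗ (q t : X →ₗ[ℂ] X)))
      (fun t => D.comap (q t : X →ₗ[ℂ] X)) F s xs
      (fun t => qi t (V t s (q s xs)) + ∫ r in s..t, qi t (V t r (q r (F r)))) := by
  set f : ℝ → X := fun t => q t (F t) with hfd
  have hf : ContinuousOn f (Ici 0) := continuousOn_apply hq.c hF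
  have hf' : ContinuousOn (fun t => q' t (F t) + q t (F' t)) (Ici 0) :=
    (continuousOn_apply hq.c' hF).add (continuousOn_apply hq.c hF')
  set z : ℝ → X := fun t => V t s (q s xs) + ∫ r in s..t, V t r (f r) with hz
  obtain ⟨hzs, hzc, hAz, hzD, hzd⟩ := hV.sol' hf hf'
    (fun t ht => (hq.sc (t + 1)).rd_apply ⟨ht, by linarith⟩ (hFd t ht)) hs hx (z := z) (fun t _ => rfl)
  set x : ℝ → X := fun t => qi t (V t s (q s xs)) + ∫ r in s..t, qi t (V t r (q r (F r))) with hxd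
  have hsub : Ici s ⊆ Ici 0 := Ici_subset_Ici.2 hs
  have hxz : ∀ t, s ≤ t → x t = qi t (z t) := by
    intro t ht
    have hc : ContinuousOn (fun r => V t r (f r)) (Icc s t) :=
      continuousOn_apply (fun x => (hV.ev.cont_right t x).continuousOn) (hf.mono (Icc_subset_Ici_self.trans hsub))
    simp only [hxd, hz, map_add]
    rw [ContinuousLinearMap.intervalIntegral_comp_comm _ (hc.intervalIntegrable_of_Icc ht)]
  have hqx : ∀ t, s ≤ t → q t (x t) = z t := fun t ht => by rw [hxz t ht, hq.right]
  have hxc : ContinuousOn x (Ici s) :=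
    (continuousOn_apply (fun x => (hq.ci x).mono hsub) hzc).congr hxz
  have hyc : ContinuousOn (fun t => qi t (A t (q t (x t))) + F t) (Ici s) := by
    refine ((continuousOn_apply (fun x => (hq.ci x).mono hsub) hAz).add (hF.mono hsub)).congr fun t ht => ?_
    simp only [hqx t ht]
    rfl
  have hrd : ∀ t, s ≤ t → HasDerivWithinAt x (qi t (A t (q t (x t))) + F t) (Ici t) t := by
    intro t ht
    have h1 := (hq.sci (t + 1)).rd_apply ⟨hs.trans ht, by linarith⟩ (hzd t ht)
    refine (h1.congr (fun r hr => hxz r (ht.trans hr)) (hxz t ht)).congr_deriv ?_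
    rw [hqx t ht]
    simp [hfd, hq.left]
    abel
  exact ⟨hxc, by rw [hxz s le_rfl, hzs, hq.left], fun t ht => by
    show q t (x t) ∈ D
    rw [hqx t ht]; exact hzD t ht, fun t ht => two_sided hxc hyc hrd ht, hyc.mono Ioi_subset_Ici_self⟩

lemma main_unique (hq : QD q qi q') (hV : PV A D (fun t => (q' t).comp (qi t)) V) {F : ℝ → X}
    (hF : ContinuousOn F (Ici 0)) {s : ℝ} (hs : 0 ≤ s) {xs : X} {x : ℝ → X}
    (hx : NBCS.IsClassicalSolution (fun t => (qi t : X →ₗ[ℂ] X) ∘ₗ (A t ∘ₗ (q t : X →ₗ[ℂ] X)))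
      (fun t => D.comap (q t : X →ₗ[ℂ] X)) F s xs x) :
    ∀ t, s ≤ t → x t = qi t (V t s (q s xs)) + ∫ r in s..t, qi t (V t r (q r (F r))) := by
  obtain ⟨hxc, hxs, hxD, hxd, -⟩ := hx
  have hsub : Ici s ⊆ Ici 0 := Ici_subset_Ici.2 hs
  have hf : ContinuousOn (fun t => q t (F t)) (Ici 0) := continuousOn_apply hq.c hF
  intro t ht
  have h1 := hV.uniq hf hs (z := fun t => q t (x t)) (continuousOn_apply (fun x => (hq.c x).mono hsub) hxc)
    hxD (fun t ht => by
      have h2 := (hq.sc (t + 1)).rd_apply ⟨hs.trans ht.le, by linarith⟩ ((hxd t ht).hasDerivWithinAt (s := Ici t))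
      refine h2.congr_deriv ?_
      simp [hq.left, hq.right]
      abel) t ht
  have h2 := congrArg (qi t) h1
  have hc : ContinuousOn (fun r => V t r (q r (F r))) (Icc s t) :=
    continuousOn_apply (fun x => (hV.ev.cont_right t x).continuousOn) (hf.mono (Icc_subset_Ici_self.trans hsub))
  rw [hq.left, map_add, hxs, ← ContinuousLinearMap.intervalIntegral_comp_comm _ (hc.intervalIntegrable_of_Icc ht)] at h2
  exact h2

lemma main_gen (hq : QD q qi q') (hV : PV A D (fun t => (q' t).comp (qi t)) V) (hD : Dense (D : Set X)) :
    NBCS.Generates (fun t => (qi t : X →ₗ[ℂ] X) ∘ₗ (A t ∘ₗ (q t : X →ₗ[ℂ] X)))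
      (fun t => D.comap (q t : X →ₗ[ℂ] X)) (fun t s => (qi t).comp ((V t s).comp (q s)))
      (fun t => D.comap (q t : X →ₗ[ℂ] X)) := by
  have hex := fun s (hs : 0 ≤ s) xs (hx : q s xs ∈ D) => main_exists hq hV (F := fun _ => 0) (F' := fun _ => 0)
    continuousOn_const continuousOn_const (fun t _ => hasDerivWithinAt_const _ _ _) hs hx
  simp only [map_zero, intervalIntegral.integral_zero, add_zero] at hex
  refine ⟨⟨fun t ht => ?_, fun s r t hs hsr hrt => ?_, fun x => ?_⟩, fun t ht => ?_, fun t ht => le_rfl,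
    fun s t hs hst x hx => ?_, hex, fun s hs xs hxs x hx t ht => ?_⟩
  · ext x; simp [hV.ev.one t t le_rfl, hq.left]
  · ext x; simp [hq.right, hV.ev.comp_apply hsr hrt]
  · have h1 : ContinuousOn (fun p : ℝ × ℝ => q p.2 x) {p : ℝ × ℝ | 0 ≤ p.2 ∧ p.2 ≤ p.1} :=
      (hq.c x).comp continuousOn_snd (fun p hp => hp.1)
    have h2 : ContinuousOn (fun p : ℝ × ℝ => V p.1 p.2 (q p.2 x)) {p : ℝ × ℝ | 0 ≤ p.2 ∧ p.2 ≤ p.1} :=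
      continuousOn_apply (G := fun p : ℝ × ℝ => V p.1 p.2) (fun x => (hV.ev.cont x).continuousOn) h1
    exact continuousOn_apply (G := fun p : ℝ × ℝ => qi p.1)
      (fun x => (hq.ci x).comp continuousOn_fst (fun p hp => mem_Ici.2 (hp.1.trans hp.2))) h2
  · intro x
    have h1 : q t x ∈ closure (D : Set X) := hD _
    have h2 := map_mem_closure (qi t).continuous h1 (t := {y | q t y ∈ D}) (fun y hy => by
      show q t (qi t y) ∈ D
      rw [hq.right]; exact hy)
    rw [hq.left] at h2
    exact h2
  · exact (hex s hs x hx).2.2.1 t hst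
  · have := main_unique hq hV continuousOn_const hs hx t ht
    simpa using this

end Fin
end KP

/-- If `{A(t)}` belongs to the Kato class with common domain `D` and `Q` is
a strongly `C²` family of isomorphisms with strongly continuous inverse, then
`{Q(t)⁻¹A(t)Q(t)}` generates a unique evolution family `W` with regularity spaces
`Y_t = Q(t)⁻¹D`; moreover for `F ∈ C¹([0,∞);X)`, `s > 0` and `x_s ∈ Q(s)⁻¹D` the problem
`ẋ(t) = Q(t)⁻¹A(t)Q(t)x(t) + F(t)`, `x(s) = x_s` has the unique classical solution
`x(t) = W(t,s)x_s + ∫_s^t W(t,r)F(r) dr`. -/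
theorem similar_kato_class_generates
    {X : Type*} [NormedAddCommGroup X] [NormedSpace ℂ X] [CompleteSpace X]
    (A : ℝ → X →ₗ[ℂ] X) (domA : ℝ → Submodule ℂ X) (D : Submodule ℂ X)
    (hA : NBCS.KatoClass A domA D)
    (Q : ℝ → X ≃L[ℂ] X)
    (hQ : ∀ x : X, ContDiffOn ℝ 2 (fun t => (Q t : X →L[ℂ] X) x) (Set.Ici (0:ℝ)))
    (hQinv : ∀ x : X, ContinuousOn (fun t => ((Q t).symm : X →L[ℂ] X) x) (Set.Ici (0:ℝ))) :
    ∃ W : ℝ → ℝ → X →L[ℂ] X,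
      NBCS.Generates
        (fun t => (((Q t).symm : X →L[ℂ] X) : X →ₗ[ℂ] X) ∘ₗ
                    (A t ∘ₗ (((Q t : X →L[ℂ] X)) : X →ₗ[ℂ] X)))
        (fun t => D.comap (((Q t : X →L[ℂ] X)) : X →ₗ[ℂ] X))
        W
        (fun t => D.comap (((Q t : X →L[ℂ] X)) : X →ₗ[ℂ] X)) ∧
      (∀ W' : ℝ → ℝ → X →L[ℂ] X,
        NBCS.Generates
          (fun t => (((Q t).symm : X →L[ℂ] X) : X →ₗ[ℂ] X) ∘ₗ
                      (A t ∘ₗ (((Q t : X →L[ℂ] X)) : X →ₗ[ℂ] X)))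
          (fun t => D.comap (((Q t : X →L[ℂ] X)) : X →ₗ[ℂ] X))
          W'
          (fun t => D.comap (((Q t : X →L[ℂ] X)) : X →ₗ[ℂ] X)) →
        ∀ s t : ℝ, 0 ≤ s → s ≤ t → W' t s = W t s) ∧
      ∀ F : ℝ → X, ContDiffOn ℝ 1 F (Set.Ici (0:ℝ)) →
        ∀ s : ℝ, 0 < s →
          ∀ xs ∈ D.comap (((Q s : X →L[ℂ] X)) : X →ₗ[ℂ] X),
            NBCS.IsClassicalSolution
              (fun t => (((Q t).symm : X →L[ℂ] X) : X →ₗ[ℂ] X) ∘ₗ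
                          (A t ∘ₗ (((Q t : X →L[ℂ] X)) : X →ₗ[ℂ] X)))
              (fun t => D.comap (((Q t : X →L[ℂ] X)) : X →ₗ[ℂ] X)) F s xs
              (fun t => W t s xs + ∫ r in s..t, W t r (F r)) ∧
            ∀ x : ℝ → X,
              NBCS.IsClassicalSolution
                (fun t => (((Q t).symm : X →L[ℂ] X) : X →ₗ[ℂ] X) ∘ₗ
                            (A t ∘ₗ (((Q t : X →L[ℂ] X)) : X →ₗ[ℂ] X)))
                (fun t => D.comap (((Q t : X →L[ℂ] X)) : X →ₗ[ℂ] X)) F s xs x →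
              ∀ t, s ≤ t → x t = W t s xs + ∫ r in s..t, W t r (F r) := by
  obtain ⟨T, K, a, a', hK⟩ := KP.exists_KD_of_kato hA
  obtain ⟨q', q'', hq, hq'⟩ := KP.QD.exists_of hQ
  obtain ⟨V, hV⟩ := hK.exists_PV (fun T0 => (hq' T0).comp (hq.sci T0))
  have hgen := KP.main_gen hq hV hK.dense
  refine ⟨fun t s => ((Q t).symm : X →L[ℂ] X).comp ((V t s).comp (Q s : X →L[ℂ] X)), hgen, ?_, ?_⟩
  · intro W' hW' s t hs hst
    ext x
    have hd : Dense ((D.comap ((Q s : X →L[ℂ] X) : X →ₗ[ℂ] X) : Submodule ℂ X) : Set X) := hgen.2.1 s hs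
    have he := Continuous.ext_on hd (W' t s).continuous
      ((((Q t).symm : X →L[ℂ] X).comp ((V t s).comp (Q s : X →L[ℂ] X)))).continuous (fun y hy =>
        hgen.2.2.2.2.2 s hs y hy _ (hW'.2.2.2.2.1 s hs y hy) t hst)
    exact congrFun he x
  · intro F hF s hs xs hxs
    have hFc : ContinuousOn F (Ici 0) := hF.continuousOn
    have hF' : ContinuousOn (derivWithin F (Ici 0)) (Ici 0) :=
      hF.continuousOn_derivWithin (uniqueDiffOn_Ici 0) le_rfl
    have hFd : ∀ t, 0 ≤ t → HasDerivWithinAt F (derivWithin F (Ici 0) t) (Ici t) t := fun t ht =>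
      ((hF.differentiableOn (by simp)) t ht).hasDerivWithinAt.mono (Ici_subset_Ici.2 ht)
    exact ⟨KP.main_exists hq hV hFc hF' hFd hs.le hxs,
      fun x hx => KP.main_unique hq hV hFc hs.le hx⟩
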